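/- For every 1 < c < 3/2, the set of positive integers n that cannot be represented as n = ⌊m^c⌋ + ⌊p^c⌋ with m a positive integer and p a prime has natural density zero; that is, E_c(x)/x → 0 as x → ∞, where E_c(x) counts the non-representable integers n ≤ x. -/

import Mathlib

/-- The additive character `x ↦ exp (2πix)` of the real line. -/
noncomputable def unitExp (x : ℝ) : ℂ := Complex.exp ((2 * Real.pi * x : ℝ) * Complex.I)

lemma unitExp_add (x y : ℝ) : unitExp (x + y) = unitExp x * unitExp y := by
  rw [unitExp, unitExp, unitExp, ← Complex.exp_add]
  push_cast
  ring_nf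

lemma norm_unitExp (x : ℝ) : ‖unitExp x‖ = 1 := Complex.norm_exp_ofReal_mul_I _

lemma unitExp_intCast (k : ℤ) : unitExp k = 1 := by
  rw [unitExp, Complex.exp_eq_one_iff]
  exact ⟨k, by push_cast; ring⟩

lemma unitExp_nat_mul (n : ℕ) (x : ℝ) : unitExp (n * x) = unitExp x ^ n := by
  rw [unitExp, unitExp, ← Complex.exp_nat_mul]
  push_cast
  ring_nf

lemma unitExp_neg (x : ℝ) : unitExp (-x) = (starRingEnd ℂ) (unitExp x) := by
  rw [unitExp, unitExp, ← Complex.exp_conj, map_mul, Complex.conj_ofReal, Complex.conj_I]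
  push_cast
  ring_nf

lemma unitExp_re (x : ℝ) : (unitExp x).re = Real.cos (2 * Real.pi * x) := by
  rw [unitExp, Complex.exp_ofReal_mul_I_re]

lemma norm_unitExp_sub_one_le (x : ℝ) : ‖unitExp x - 1‖ ≤ 2 * Real.pi * |x| := by
  have h := Real.norm_exp_I_mul_ofReal_sub_one_le (x := 2 * Real.pi * x)
  rw [mul_comm Complex.I] at h
  simpa [unitExp, abs_mul, abs_of_pos Real.pi_pos] using h

/-- The real cotangent written as a quotient, evaluated at `π t`. -/
noncomputable def cotPi (t : ℝ) : ℝ := Real.cos (Real.pi * t) / Real.sin (Real.pi * t)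

lemma two_mul_le_sin_pi_mul {δ t : ℝ} (h0 : 0 < δ) (h1 : δ ≤ t) (h2 : t ≤ 1 - δ) :
    2 * δ ≤ Real.sin (Real.pi * t) := by
  have hpi := Real.pi_pos
  have key : ∀ s : ℝ, δ ≤ s → s ≤ 1 / 2 → 2 * δ ≤ Real.sin (Real.pi * s) := by
    intro s hs1 hs2
    have := Real.mul_le_sin (x := Real.pi * s) (by positivity [h0.le.trans hs1]) (by nlinarith)
    have h : 2 / Real.pi * (Real.pi * s) = 2 * s := by field_simp
    linarith
  rcases le_total t (1 / 2) with h | h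
  · exact key t h1 h
  · have := key (1 - t) (by linarith) (by linarith)
    rwa [mul_sub, mul_one, Real.sin_pi_sub] at this

lemma cotPi_antitone {s t : ℝ} (hs : 0 < Real.sin (Real.pi * s)) (ht : 0 < Real.sin (Real.pi * t))
    (hst : s ≤ t) (hd : t - s ≤ 1) : cotPi t ≤ cotPi s := by
  have hpi := Real.pi_pos
  have h : 0 ≤ Real.sin (Real.pi * t - Real.pi * s) :=
    Real.sin_nonneg_of_nonneg_of_le_pi (by nlinarith) (by nlinarith)
  rw [Real.sin_sub] at h
  rw [cotPi, cotPi, div_le_div_iff₀ ht hs]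
  linarith

/-- The inverse of `unitExp t - 1`. -/
noncomputable def invUnitExpSubOne (t : ℝ) : ℂ := -1 / 2 - (cotPi t / 2 : ℝ) * Complex.I

lemma invUnitExpSubOne_mul {t : ℝ} (ht : Real.sin (Real.pi * t) ≠ 0) :
    invUnitExpSubOne t * (unitExp t - 1) = 1 := by
  have hu : unitExp t = (Real.cos (2 * (Real.pi * t)) : ℂ) +
      (Real.sin (2 * (Real.pi * t)) : ℂ) * Complex.I := by
    rw [unitExp, mul_assoc, Complex.exp_mul_I]
    push_cast
    ring
  rw [hu, invUnitExpSubOne, cotPi, Real.cos_two_mul, Real.sin_two_mul]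
  have hsq := Real.sin_sq_add_cos_sq (Real.pi * t)
  set a := Real.sin (Real.pi * t)
  set b := Real.cos (Real.pi * t)
  have ha : (a : ℂ) ≠ 0 := by exact_mod_cast ht
  have hsq' : (a : ℂ) ^ 2 + (b : ℂ) ^ 2 = 1 := by exact_mod_cast hsq
  have hI := Complex.I_sq
  push_cast
  field_simp
  linear_combination (-(2 * a : ℂ) * b ^ 2) * hI - (2 * b * Complex.I : ℂ) * hsq'

lemma norm_invUnitExpSubOne_sub (s t : ℝ) :
    ‖invUnitExpSubOne s - invUnitExpSubOne t‖ = |cotPi s - cotPi t| / 2 := by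
  have : invUnitExpSubOne s - invUnitExpSubOne t =
      ((-(cotPi s - cotPi t) / 2 : ℝ) : ℂ) * Complex.I := by
    simp only [invUnitExpSubOne]
    push_cast
    ring
  rw [this, norm_mul, Complex.norm_I, mul_one, Complex.norm_real, Real.norm_eq_abs, abs_div,
    abs_neg, abs_two]

lemma norm_invUnitExpSubOne_le {δ t : ℝ} (h0 : 0 < δ) (h : 2 * δ ≤ Real.sin (Real.pi * t)) :
    ‖invUnitExpSubOne t‖ ≤ 1 / (4 * δ) := by
  have hs : 0 < Real.sin (Real.pi * t) := by linarith
  have hsq := Real.sin_sq_add_cos_sq (Real.pi * t)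
  have : ‖invUnitExpSubOne t‖ ^ 2 = (1 / (2 * Real.sin (Real.pi * t))) ^ 2 := by
    have hre : (invUnitExpSubOne t).re = -1 / 2 := by simp [invUnitExpSubOne]
    have him : (invUnitExpSubOne t).im = -(cotPi t / 2) := by
      rw [invUnitExpSubOne, Complex.sub_im, Complex.im_ofReal_mul, Complex.I_im]
      simp
    rw [Complex.sq_norm, Complex.normSq_apply, hre, him, cotPi]
    field_simp
    linear_combination hsq
  rw [pow_left_inj₀ (norm_nonneg _) (by positivity) two_ne_zero] at this
  rw [this]
  exact one_div_le_one_div_of_le (by positivity) (by linarith)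

lemma abs_cotPi_le {δ t : ℝ} (h0 : 0 < δ) (h : 2 * δ ≤ Real.sin (Real.pi * t)) :
    |cotPi t| ≤ 1 / (2 * δ) := by
  have hs : 0 < Real.sin (Real.pi * t) := by linarith
  rw [cotPi, abs_div, abs_of_pos hs]
  exact div_le_div₀ zero_le_one (Real.abs_cos_le_one _) (by positivity) h

/-- **Kuzmin–Landau inequality**, normalized so that the differences lie in `[δ, 1 - δ]`. -/
lemma norm_sum_unitExp_le_of_diff_mem_Icc {x : ℕ → ℝ} {δ : ℝ} (h0 : 0 < δ) {a b : ℕ}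
    (hab : a ≤ b)
    (hlow : ∀ n, a ≤ n → n < b → δ ≤ x (n + 1) - x n)
    (hupp : ∀ n, a ≤ n → n < b → x (n + 1) - x n ≤ 1 - δ)
    (hmono : ∀ n, a ≤ n → n + 1 < b → x (n + 1) - x n ≤ x (n + 1 + 1) - x (n + 1)) :
    ‖∑ n ∈ Finset.Ico a b, unitExp (x n)‖ ≤ 1 / δ := by
  rcases hab.eq_or_lt with rfl | hab
  · simp [h0.le]
  have hsin : ∀ n, a ≤ n → n < b → 2 * δ ≤ Real.sin (Real.pi * (x (n + 1) - x n)) :=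
    fun n h1 h2 => two_mul_le_sin_pi_mul h0 (hlow n h1 h2) (hupp n h1 h2)
  have hpos : ∀ n, a ≤ n → n < b → 0 < Real.sin (Real.pi * (x (n + 1) - x n)) :=
    fun n h1 h2 => lt_of_lt_of_le (by linarith) (hsin n h1 h2)
  have hstep : ∀ n, a ≤ n → n < b → unitExp (x n) =
      (unitExp (x (n + 1)) - unitExp (x n)) * invUnitExpSubOne (x (n + 1) - x n) := by
    intro n h1 h2
    have h := invUnitExpSubOne_mul (hpos n h1 h2).ne'
    have h' : unitExp (x (n + 1)) = unitExp (x n) * unitExp (x (n + 1) - x n) := by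
      rw [← unitExp_add]
      ring_nf
    rw [h']
    linear_combination (-unitExp (x n)) * h
  have main : ∀ m, a + 1 ≤ m → m ≤ b →
      ‖∑ n ∈ Finset.Ico a m, unitExp (x n) -
          unitExp (x m) * invUnitExpSubOne (x m - x (m - 1)) +
          unitExp (x a) * invUnitExpSubOne (x (a + 1) - x a)‖ ≤
        (cotPi (x (a + 1) - x a) - cotPi (x m - x (m - 1))) / 2 := by
    intro m hm
    induction m, hm using Nat.le_induction with
    | base =>
      intro _
      have := hstep a le_rfl hab
      simp only [Nat.Ico_succ_singleton, Finset.sum_singleton, Nat.add_sub_cancel, sub_self,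
        zero_div]
      rw [norm_le_zero_iff]
      linear_combination this
    | succ m hm ih =>
      intro hmb
      have hma : a ≤ m := by omega
      obtain ⟨j, rfl⟩ : ∃ j, m = j + 1 := ⟨m - 1, by omega⟩
      have ih := ih (by omega)
      simp only [Nat.add_sub_cancel] at ih ⊢
      rw [Finset.sum_Ico_succ_top hma]
      have hs := hstep (j + 1) hma (by omega)
      have hanti : cotPi (x (j + 1 + 1) - x (j + 1)) ≤ cotPi (x (j + 1) - x j) := by
        refine cotPi_antitone (hpos j (by omega) (by omega)) (hpos (j + 1) hma (by omega))
          (hmono j (by omega) (by omega)) ?_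
        linarith [hupp (j + 1) hma (by omega), hlow j (by omega) (by omega)]
      have hn : ‖unitExp (x (j + 1)) * (invUnitExpSubOne (x (j + 1) - x j) -
          invUnitExpSubOne (x (j + 1 + 1) - x (j + 1)))‖ =
          (cotPi (x (j + 1) - x j) - cotPi (x (j + 1 + 1) - x (j + 1))) / 2 := by
        rw [norm_mul, norm_unitExp, one_mul, norm_invUnitExpSubOne_sub,
          abs_of_nonneg (by linarith)]
      refine (norm_add_le_of_le ih hn.le).trans' (le_of_eq ?_) |>.trans (le_of_eq (by ring))
      congr 1
      linear_combination hs
  obtain ⟨j, rfl⟩ : ∃ j, b = j + 1 := ⟨b - 1, by omega⟩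
  have hmain := main (j + 1) (by omega) le_rfl
  simp only [Nat.add_sub_cancel] at hmain
  have hja : a ≤ j := by omega
  have h1 : ‖unitExp (x (j + 1)) * invUnitExpSubOne (x (j + 1) - x j)‖ ≤ 1 / (4 * δ) := by
    rw [norm_mul, norm_unitExp, one_mul]
    exact norm_invUnitExpSubOne_le h0 (hsin j hja (by omega))
  have h2 : ‖unitExp (x a) * invUnitExpSubOne (x (a + 1) - x a)‖ ≤ 1 / (4 * δ) := by
    rw [norm_mul, norm_unitExp, one_mul]
    exact norm_invUnitExpSubOne_le h0 (hsin a le_rfl hab)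
  have h3 := abs_le.mp (abs_cotPi_le h0 (hsin a le_rfl hab))
  have h4 := abs_le.mp (abs_cotPi_le h0 (hsin j hja (by omega)))
  have h5 := norm_add_le_of_le (norm_sub_le_of_le hmain h2) h1
  have h6 : 1 / δ = 1 / (4 * δ) + 1 / (4 * δ) + 1 / (2 * δ) := by field_simp; norm_num
  rw [h6]
  refine (h5.trans' (le_of_eq ?_)).trans (by linarith)
  congr 1
  ring

lemma norm_sum_unitExp_le_card (x : ℕ → ℝ) {a b : ℕ} (hab : a ≤ b) :
    ‖∑ n ∈ Finset.Ico a b, unitExp (x n)‖ ≤ (b : ℝ) - a := by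
  refine (norm_sum_le _ _).trans ?_
  simp [norm_unitExp, Nat.cast_sub hab]

/-- A sequence that is monotone on `[a, b)` crosses a threshold at a single place. -/
lemma exists_threshold {D : ℕ → ℝ} {a b : ℕ} (hab : a ≤ b)
    (hmono : ∀ n, a ≤ n → n + 1 < b → D n ≤ D (n + 1)) (t : ℝ) :
    ∃ k, a ≤ k ∧ k ≤ b ∧ (∀ n, a ≤ n → n < k → D n < t) ∧ ∀ n, k ≤ n → n < b → t ≤ D n := by
  induction b, hab using Nat.le_induction with
  | base => exact ⟨a, le_rfl, le_rfl, fun n h1 h2 => by omega, fun n h1 h2 => by omega⟩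
  | succ b hab ih =>
    obtain ⟨k, hak, hkb, h1, h2⟩ := ih fun n h1 h2 => hmono n h1 (by omega)
    rcases lt_or_ge (D b) t with hb | hb
    · have hk : k = b := by
        by_contra hne
        have := h2 (b - 1) (by omega) (by omega)
        have h3 := hmono (b - 1) (by omega) (by omega)
        rw [Nat.sub_add_cancel (by omega)] at h3
        linarith
      subst hk
      refine ⟨k + 1, by omega, le_rfl, fun n hn1 hn2 => ?_, fun n hn1 hn2 => by omega⟩
      rcases Nat.lt_succ_iff_lt_or_eq.mp hn2 with h | rfl
      · exact h1 n hn1 h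
      · exact hb
    · refine ⟨k, hak, by omega, h1, fun n hn1 hn2 => ?_⟩
      rcases Nat.lt_succ_iff_lt_or_eq.mp hn2 with h | rfl
      · exact h2 n hn1 h
      · exact hb

lemma mul_sub_le_of_step {D : ℕ → ℝ} {l : ℝ} {a b : ℕ}
    (hstep : ∀ n, a ≤ n → n + 1 < b → l ≤ D (n + 1) - D n) :
    ∀ n, a ≤ n → n < b → l * ((n : ℝ) - a) ≤ D n - D a := by
  intro n hn
  induction n, hn using Nat.le_induction with
  | base => simp
  | succ n hn ih =>
    intro h
    have := hstep n hn h
    have := ih (by omega)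
    push_cast
    linarith

lemma sub_le_mul_of_step {D : ℕ → ℝ} {u : ℝ} {a b : ℕ}
    (hstep : ∀ n, a ≤ n → n + 1 < b → D (n + 1) - D n ≤ u) :
    ∀ n, a ≤ n → n < b → D n - D a ≤ u * ((n : ℝ) - a) := by
  intro n hn h
  have := mul_sub_le_of_step (D := fun n => -D n) (l := -u) (a := a) (b := b)
    (fun n h1 h2 => by linarith [hstep n h1 h2]) n hn h
  linarith

/-- A sequence with steps at least `l` stays in an interval of length `r` for at most
`r / l + 1` indices. -/
lemma length_le_of_step {D : ℕ → ℝ} {l r t : ℝ} (hl : 0 < l) (hr : 0 ≤ r) {a b : ℕ}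
    (hstep : ∀ n, a ≤ n → n + 1 < b → l ≤ D (n + 1) - D n)
    (h1 : ∀ n, a ≤ n → n < b → t ≤ D n) (h2 : ∀ n, a ≤ n → n < b → D n ≤ t + r) :
    (b : ℝ) - a ≤ r / l + 1 := by
  rcases le_or_gt b a with hab | hab
  · have : (b : ℝ) ≤ a := by exact_mod_cast hab
    have : 0 ≤ r / l := by positivity
    linarith
  have := mul_sub_le_of_step hstep (b - 1) (by omega) (by omega)
  have h3 := h1 a le_rfl hab
  have h4 := h2 (b - 1) (by omega) (by omega)
  rw [Nat.cast_sub (by omega), Nat.cast_one] at this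
  rw [← sub_le_iff_le_add, le_div_iff₀ hl]
  linarith

/-- Exponential sum over a block on which the differences stay between consecutive integers. -/
lemma norm_sum_unitExp_le_of_floor_eq {x : ℕ → ℝ} {l : ℝ} (hl : 0 < l) (hl' : l ≤ 1 / 4)
    {a b : ℕ} (hab : a ≤ b) (k : ℤ)
    (hstep : ∀ n, a ≤ n → n + 1 < b → l ≤ (x (n + 1 + 1) - x (n + 1)) - (x (n + 1) - x n))
    (h1 : ∀ n, a ≤ n → n < b → (k : ℝ) ≤ x (n + 1) - x n)
    (h2 : ∀ n, a ≤ n → n < b → x (n + 1) - x n ≤ k + 1) :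
    ‖∑ n ∈ Finset.Ico a b, unitExp (x n)‖ ≤ 4 / √l := by
  set δ := √l with hδ
  have hδ0 : 0 < δ := Real.sqrt_pos.mpr hl
  have hδl : δ * δ = l := Real.mul_self_sqrt hl.le
  have hδ1 : δ ≤ 1 / 2 := by nlinarith
  have hmono : ∀ n, a ≤ n → n + 1 < b → x (n + 1) - x n ≤ x (n + 1 + 1) - x (n + 1) :=
    fun n hn1 hn2 => by linarith [hstep n hn1 hn2]
  obtain ⟨u, hau, hub, hu1, hu2⟩ := exists_threshold (D := fun n => x (n + 1) - x n) hab hmono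
    (k + δ)
  obtain ⟨v, huv, hvb, hv1, hv2⟩ := exists_threshold (D := fun n => x (n + 1) - x n) hub
    (fun n hn1 hn2 => hmono n (by omega) hn2) (k + 1 - δ)
  rw [← Finset.sum_Ico_consecutive _ (hau.trans huv) hvb,
    ← Finset.sum_Ico_consecutive _ hau huv]
  have b1 : ‖∑ n ∈ Finset.Ico a u, unitExp (x n)‖ ≤ δ / l + 1 :=
    (norm_sum_unitExp_le_card x hau).trans <|
      length_le_of_step (D := fun n => x (n + 1) - x n) (t := k) hl hδ0.le
        (fun n hn1 hn2 => hstep n hn1 (by omega)) (fun n hn1 hn2 => h1 n hn1 (by omega))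
        (fun n hn1 hn2 => (hu1 n hn1 hn2).le)
  have b3 : ‖∑ n ∈ Finset.Ico v b, unitExp (x n)‖ ≤ δ / l + 1 :=
    (norm_sum_unitExp_le_card x hvb).trans <|
      length_le_of_step (D := fun n => x (n + 1) - x n) (t := k + 1 - δ) hl hδ0.le
        (fun n hn1 hn2 => hstep n (by omega) (by omega)) hv2
        (fun n hn1 hn2 => by linarith [h2 n (by omega) hn2])
  have b2 : ‖∑ n ∈ Finset.Ico u v, unitExp (x n)‖ ≤ 1 / δ := by
    have := norm_sum_unitExp_le_of_diff_mem_Icc (x := fun n => x n - (k * n : ℤ)) hδ0 huv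
      (fun n hn1 hn2 => by push_cast; linarith [hu2 n hn1 (by omega)])
      (fun n hn1 hn2 => by push_cast; linarith [hv1 n hn1 hn2])
      (fun n hn1 hn2 => by push_cast; linarith [hmono n (by omega) (by omega)])
    refine this.trans' (le_of_eq ?_)
    congr 1
    refine Finset.sum_congr rfl fun n _ => ?_
    conv_lhs => rw [← sub_add_cancel (x n) ((k * n : ℤ) : ℝ), unitExp_add, unitExp_intCast,
      mul_one]
  have h3 := norm_add_le_of_le (norm_add_le_of_le b1 b2) b3
  refine h3.trans ?_
  rw [← hδl]
  have e1 : δ / (δ * δ) = 1 / δ := by field_simp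
  have e2 : 2 ≤ 1 / δ := by rw [le_div_iff₀ hδ0]; linarith
  have e3 : 4 / δ = 4 * (1 / δ) := by ring
  rw [e1, e3]
  linarith

lemma norm_sum_unitExp_le_of_diff_le {x : ℕ → ℝ} {l : ℝ} (hl : 0 < l) (hl' : l ≤ 1 / 4)
    {a b : ℕ} (hab : a ≤ b) (k : ℤ) (j : ℕ)
    (hstep : ∀ n, a ≤ n → n + 1 < b → l ≤ (x (n + 1 + 1) - x (n + 1)) - (x (n + 1) - x n))
    (h1 : ∀ n, a ≤ n → n < b → (k : ℝ) ≤ x (n + 1) - x n)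
    (h2 : ∀ n, a ≤ n → n < b → x (n + 1) - x n < k + j) :
    ‖∑ n ∈ Finset.Ico a b, unitExp (x n)‖ ≤ j * (4 / √l) := by
  induction j generalizing b with
  | zero =>
    rcases hab.eq_or_lt with rfl | h
    · simp
    · have := h1 a le_rfl h
      have := h2 a le_rfl h
      push_cast at this
      linarith
  | succ j ih =>
    obtain ⟨u, hau, hub, hu1, hu2⟩ := exists_threshold (D := fun n => x (n + 1) - x n) hab
      (fun n hn1 hn2 => by linarith [hstep n hn1 hn2]) (k + j)
    rw [← Finset.sum_Ico_consecutive _ hau hub]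
    have b1 := ih hau (fun n hn1 hn2 => hstep n hn1 (by omega))
      (fun n hn1 hn2 => h1 n hn1 (by omega)) hu1
    have b2 := norm_sum_unitExp_le_of_floor_eq hl hl' hub (k + j)
      (fun n hn1 hn2 => hstep n (by omega) hn2)
      (fun n hn1 hn2 => by push_cast; exact hu2 n hn1 hn2)
      (fun n hn1 hn2 => by
        have := h2 n (by omega) hn2
        push_cast at this ⊢
        linarith)
    refine (norm_add_le_of_le b1 b2).trans (le_of_eq ?_)
    push_cast
    ring

/-- **Van der Corput's second derivative test**, in terms of second differences. -/
lemma norm_sum_unitExp_le_of_second_diff {x : ℕ → ℝ} {l A : ℝ} (hl : 0 < l) (hA : 1 ≤ A)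
    {a b : ℕ} (hab : a ≤ b)
    (hlow : ∀ n, a ≤ n → n + 1 < b → l ≤ (x (n + 1 + 1) - x (n + 1)) - (x (n + 1) - x n))
    (hupp : ∀ n, a ≤ n → n + 1 < b → (x (n + 1 + 1) - x (n + 1)) - (x (n + 1) - x n) ≤ A * l) :
    ‖∑ n ∈ Finset.Ico a b, unitExp (x n)‖ ≤ 4 * A * √l * ((b : ℝ) - a) + 8 / √l := by
  have hs : 0 < √l := Real.sqrt_pos.mpr hl
  have hss : √l * √l = l := Real.mul_self_sqrt hl.le
  have hba : 0 ≤ (b : ℝ) - a := sub_nonneg.mpr (by exact_mod_cast hab)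
  rcases le_or_gt l (1 / 4) with hl' | hl'
  · have hmono := mul_sub_le_of_step (D := fun n => x (n + 1) - x n) hlow
    have hgrow := sub_le_mul_of_step (D := fun n => x (n + 1) - x n) hupp
    set k := ⌊x (a + 1) - x a⌋ with hk
    set j := ⌊A * l * ((b : ℝ) - a) + 2⌋₊ with hj
    have hAl : 0 ≤ A * l := by positivity
    have hlast : ∀ n, a ≤ n → n < b → x (n + 1) - x n < k + j := by
      intro n hn1 hn2
      have e1 := hgrow n hn1 hn2
      have e2 : (n : ℝ) + 1 ≤ b := by exact_mod_cast hn2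
      have e3 : A * l * ((n : ℝ) - a) ≤ A * l * ((b : ℝ) - a) :=
        mul_le_mul_of_nonneg_left (by linarith) hAl
      have e4 := Int.lt_floor_add_one (x (a + 1) - x a)
      have e5 := Nat.lt_floor_add_one (A * l * ((b : ℝ) - a) + 2)
      simp only [← hk, ← hj] at e1 e4 e5
      linarith
    have hfirst : ∀ n, a ≤ n → n < b → (k : ℝ) ≤ x (n + 1) - x n := by
      intro n hn1 hn2
      have e1 := hmono n hn1 hn2
      have e2 : (a : ℝ) ≤ n := by exact_mod_cast hn1
      have e3 : 0 ≤ l * ((n : ℝ) - a) := mul_nonneg hl.le (by linarith)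
      have e4 := Int.floor_le (x (a + 1) - x a)
      simp only [← hk] at e1 e4
      linarith
    have := norm_sum_unitExp_le_of_diff_le hl hl' hab k j hlow hfirst hlast
    have hjle : (j : ℝ) ≤ A * l * ((b : ℝ) - a) + 2 := Nat.floor_le (by positivity)
    refine this.trans ((mul_le_mul_of_nonneg_right hjle (by positivity)).trans (le_of_eq ?_))
    have e : l * (4 / √l) = 4 * √l := by
      rw [mul_div_assoc', div_eq_iff hs.ne']
      linarith
    linear_combination A * ((b : ℝ) - a) * e
  · refine (norm_sum_unitExp_le_card x hab).trans ?_
    have h12 : 1 / 2 ≤ √l := by nlinarith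
    have : 1 ≤ 4 * A * √l := by nlinarith
    have h8 : 0 ≤ 8 / √l := by positivity
    nlinarith

lemma hasDerivAt_rpow_const' {t c : ℝ} (ht : 0 < t) :
    HasDerivAt (fun t : ℝ => t ^ c) (c * t ^ (c - 1)) t :=
  Real.hasDerivAt_rpow_const (Or.inl ht.ne')

lemma exists_second_diff_rpow_eq {c : ℝ} {t : ℝ} (ht : 0 < t) :
    ∃ s, t < s ∧ s < t + 2 ∧
      ((t + 1 + 1) ^ c - (t + 1) ^ c) - ((t + 1) ^ c - t ^ c) = c * ((c - 1) * s ^ (c - 2)) := by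
  have hd : ∀ s ∈ Set.Icc t (t + 1), HasDerivAt (fun s : ℝ => (s + 1) ^ c - s ^ c)
      (c * (s + 1) ^ (c - 1) - c * s ^ (c - 1)) s := by
    intro s hs
    have hs0 : 0 < s := ht.trans_le hs.1
    exact ((hasDerivAt_rpow_const' (by linarith)).comp_add_const s 1).sub (hasDerivAt_rpow_const' hs0)
  obtain ⟨u, hu, hu'⟩ := exists_hasDerivAt_eq_slope (fun s : ℝ => (s + 1) ^ c - s ^ c) _
    (show t < t + 1 by linarith) (fun s hs => (hd s hs).continuousAt.continuousWithinAt)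
    (fun s hs => hd s ⟨hs.1.le, hs.2.le⟩)
  have hu0 : 0 < u := ht.trans hu.1
  have hd2 : ∀ s ∈ Set.Icc u (u + 1), HasDerivAt (fun s : ℝ => c * s ^ (c - 1))
      (c * ((c - 1) * s ^ (c - 1 - 1))) s := by
    intro s hs
    exact (hasDerivAt_rpow_const' (hu0.trans_le hs.1)).const_mul c
  obtain ⟨s, hs, hs'⟩ := exists_hasDerivAt_eq_slope (fun s : ℝ => c * s ^ (c - 1)) _
    (show u < u + 1 by linarith) (fun s hs => (hd2 s hs).continuousAt.continuousWithinAt)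
    (fun s hs => hd2 s ⟨hs.1.le, hs.2.le⟩)
  refine ⟨s, by linarith [hu.1, hs.1], by linarith [hu.2, hs.2], ?_⟩
  have e : c - 2 = c - 1 - 1 := by ring
  rw [e, hs']
  simp only [add_sub_cancel_left, div_one] at hu' ⊢
  rw [hu']

/-- Bound for exponential sums with phase `θ n ^ c` over subintervals of `[Q, L Q]`. -/
lemma exists_norm_sum_unitExp_rpow_le {c : ℝ} (hc1 : 1 < c) (hc2 : c < 2) {L : ℕ} (hL : 1 ≤ L) :
    ∃ C : ℝ, 0 < C ∧ ∀ Q : ℕ, 1 ≤ Q → ∀ a b : ℕ, Q ≤ a → a ≤ b → b ≤ L * Q →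
      ∀ θ : ℝ, θ ≠ 0 → ‖∑ n ∈ Finset.Ico a b, unitExp (θ * (n : ℝ) ^ c)‖ ≤
        C * (√|θ| * (Q : ℝ) ^ (c / 2 - 1) * ((b : ℝ) - a) + (Q : ℝ) ^ (1 - c / 2) / √|θ|) := by
  have hL0 : (0 : ℝ) < L := by exact_mod_cast hL
  have hL1 : (1 : ℝ) ≤ L := by exact_mod_cast hL
  set A : ℝ := (L : ℝ) ^ (2 - c) with hA
  have hA1 : 1 ≤ A := Real.one_le_rpow hL1 (by linarith)
  set m : ℝ := √(c * (c - 1) * (L : ℝ) ^ (c - 2)) with hm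
  have hm0' : 0 < c * (c - 1) * (L : ℝ) ^ (c - 2) := by
    have : 0 < c - 1 := by linarith
    positivity
  have hm0 : 0 < m := Real.sqrt_pos.mpr hm0'
  refine ⟨4 * A * m + 8 / m, by positivity, fun Q hQ a b hQa hab hbQ θ hθ => ?_⟩
  have hQ0 : (0 : ℝ) < Q := by exact_mod_cast hQ
  wlog hpos : 0 < θ generalizing θ
  · have := this (-θ) (neg_ne_zero.mpr hθ) (by
      rcases lt_or_gt_of_ne hθ with h | h
      · linarith
      · exact absurd h hpos)
    rw [abs_neg] at this
    refine this.trans' (le_of_eq ?_)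
    rw [← Complex.norm_conj, map_sum]
    congr 1
    refine Finset.sum_congr rfl fun n _ => ?_
    rw [← unitExp_neg, neg_mul]
  rw [abs_of_pos hpos]
  set l : ℝ := θ * (c * (c - 1) * ((L : ℝ) * Q) ^ (c - 2)) with hl
  have hcc : 0 < c * (c - 1) := by nlinarith
  have hl0 : 0 < l := by positivity
  have hstep : ∀ n : ℕ, a ≤ n → n + 1 < b →
      l ≤ (θ * ((n + 1 + 1 : ℕ) : ℝ) ^ c - θ * ((n + 1 : ℕ) : ℝ) ^ c) -
        (θ * ((n + 1 : ℕ) : ℝ) ^ c - θ * (n : ℝ) ^ c) ∧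
      (θ * ((n + 1 + 1 : ℕ) : ℝ) ^ c - θ * ((n + 1 : ℕ) : ℝ) ^ c) -
        (θ * ((n + 1 : ℕ) : ℝ) ^ c - θ * (n : ℝ) ^ c) ≤ A * l := by
    intro n hn1 hn2
    have hnQ : (Q : ℝ) ≤ n := by exact_mod_cast hQa.trans hn1
    have hnL : (n : ℝ) + 2 ≤ L * Q := by exact_mod_cast (show n + 2 ≤ b by omega).trans hbQ
    obtain ⟨s, hs1, hs2, hs3⟩ := exists_second_diff_rpow_eq (c := c) (hQ0.trans_le hnQ)
    have hs0 : 0 < s := by linarith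
    push_cast
    have e : (θ * ((n : ℝ) + 1 + 1) ^ c - θ * ((n : ℝ) + 1) ^ c) -
        (θ * ((n : ℝ) + 1) ^ c - θ * (n : ℝ) ^ c) = θ * (c * (c - 1) * s ^ (c - 2)) := by
      linear_combination θ * hs3
    rw [e]
    constructor
    · rw [hl]
      have := Real.rpow_le_rpow_of_nonpos hs0 (show s ≤ L * Q by linarith)
        (show c - 2 ≤ 0 by linarith)
      gcongr
    · have h1 := Real.rpow_le_rpow_of_nonpos hQ0 (show (Q : ℝ) ≤ s by linarith)
        (show c - 2 ≤ 0 by linarith)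
      have h2 : A * l = θ * (c * (c - 1) * (Q : ℝ) ^ (c - 2)) := by
        rw [hl, hA, Real.mul_rpow hL0.le hQ0.le]
        have : (L : ℝ) ^ (2 - c) * (L : ℝ) ^ (c - 2) = 1 := by
          rw [← Real.rpow_add hL0]
          simp
        linear_combination (θ * (c * (c - 1)) * (Q : ℝ) ^ (c - 2)) * this
      rw [h2]
      gcongr
  have main := norm_sum_unitExp_le_of_second_diff (x := fun n : ℕ => θ * (n : ℝ) ^ c) hl0 hA1 hab
    (fun n hn1 hn2 => (hstep n hn1 hn2).1) (fun n hn1 hn2 => (hstep n hn1 hn2).2)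
  have hsq : √l = √θ * m * (Q : ℝ) ^ (c / 2 - 1) := by
    have : l = θ * (c * (c - 1) * (L : ℝ) ^ (c - 2)) * (Q : ℝ) ^ (c - 2) := by
      rw [hl, Real.mul_rpow hL0.le hQ0.le]
      ring
    rw [this, Real.sqrt_mul (by positivity), Real.sqrt_mul hpos.le, ← hm]
    congr 1
    rw [Real.sqrt_eq_rpow, ← Real.rpow_mul hQ0.le]
    congr 1
    ring
  have hinv : (Q : ℝ) ^ (1 - c / 2) = ((Q : ℝ) ^ (c / 2 - 1))⁻¹ := by
    rw [← Real.rpow_neg hQ0.le]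
    congr 1
    ring
  refine main.trans ?_
  rw [hsq, hinv]
  have hθ0 : 0 < √θ := Real.sqrt_pos.mpr hpos
  set q := (Q : ℝ) ^ (c / 2 - 1) with hq
  have hq0 : 0 < q := by positivity
  have hba : 0 ≤ (b : ℝ) - a := sub_nonneg.mpr (by exact_mod_cast hab)
  have e1 : 8 / (√θ * m * q) = 8 / m * (q⁻¹ / √θ) := by field_simp
  rw [e1]
  have e2 : 0 ≤ 8 / m * (√θ * q * ((b : ℝ) - a)) := by positivity
  have e3 : 0 ≤ 4 * A * m * (q⁻¹ / √θ) := by positivity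
  linarith

lemma hasDerivAt_unitExp_const_mul (β t : ℝ) :
    HasDerivAt (fun t : ℝ => unitExp (β * t)) (2 * Real.pi * β * Complex.I * unitExp (β * t)) t := by
  have h : HasDerivAt (fun t : ℝ => ((2 * Real.pi * (β * t) : ℝ) : ℂ) * Complex.I)
      (((2 * Real.pi * (β * 1) : ℝ) : ℂ) * Complex.I) t :=
    (((hasDerivAt_id t).const_mul β).const_mul (2 * Real.pi)).ofReal_comp.mul_const Complex.I
  convert! h.cexp using 1
  rw [unitExp]
  push_cast
  ring

lemma fourierCoeffOn_zero_one_norm_le {f : ℝ → ℂ} {K : ℝ} (hK : ∀ t, ‖f t‖ ≤ K) (n : ℤ) :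
    ‖fourierCoeffOn (zero_lt_one' ℝ) f n‖ ≤ K := by
  rw [fourierCoeffOn_eq_integral]
  simp only [sub_zero, div_one, one_smul]
  refine (intervalIntegral.norm_integral_le_of_norm_le_const (C := K) fun t _ => ?_).trans ?_
  · rw [norm_smul, fourier_apply, Circle.norm_coe, one_mul]
    exact hK t
  · simp

/-- Two integrations by parts for a function vanishing to second order at both ends. -/
lemma fourierCoeffOn_zero_one_norm_le_div_sq {f f' f'' : ℝ → ℂ} {K : ℝ}
    (hf : ∀ t, HasDerivAt f (f' t) t) (hf' : ∀ t, HasDerivAt f' (f'' t) t)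
    (hf'' : Continuous f'') (h0 : f 0 = 0) (h1 : f 1 = 0) (h0' : f' 0 = 0) (h1' : f' 1 = 0)
    (hK : ∀ t, ‖f'' t‖ ≤ K) {n : ℤ} (hn : n ≠ 0) :
    ‖fourierCoeffOn (zero_lt_one' ℝ) f n‖ ≤ K / (n : ℝ) ^ 2 := by
  have hc' : Continuous f' := continuous_iff_continuousAt.mpr fun t => (hf' t).continuousAt
  rw [fourierCoeffOn_of_hasDerivAt (zero_lt_one' ℝ) hn (fun t _ => hf t)
    (hc'.intervalIntegrable _ _), fourierCoeffOn_of_hasDerivAt (zero_lt_one' ℝ) hn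
    (fun t _ => hf' t) (hf''.intervalIntegrable _ _), h0, h1, h0', h1']
  have hK0 : 0 ≤ K := (norm_nonneg _).trans (hK 0)
  have hb := fourierCoeffOn_zero_one_norm_le hK n
  have hn0 : 0 < |(n : ℝ)| := by positivity
  have hpi : 1 ≤ 2 * Real.pi := by linarith [Real.two_le_pi]
  have hnorm : ‖(1 / (-2 * Real.pi * Complex.I * n) : ℂ)‖ ≤ 1 / |(n : ℝ)| := by
    rw [norm_div, norm_one]
    have : ‖(-2 * Real.pi * Complex.I * n : ℂ)‖ = 2 * Real.pi * |(n : ℝ)| := by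
      simp [abs_of_pos Real.pi_pos]
    rw [this]
    exact one_div_le_one_div_of_le hn0 (by nlinarith)
  simp only [sub_zero, mul_zero, Complex.ofReal_one, Complex.ofReal_zero, zero_sub, one_mul,
    norm_mul, norm_neg]
  calc _ ≤ 1 / |(n : ℝ)| * (1 / |(n : ℝ)| * K) := by gcongr
    _ = K / (n : ℝ) ^ 2 := by
      rw [← sq_abs (n : ℝ)]
      field_simp

/-- The periodic function `x ↦ sin² (π x) e(-α {x})` has an absolutely convergent Fourier series
with quadratically decaying coefficients, uniformly in `α`. -/
lemma exists_hasSum_sin_sq_mul_unitExp_floor : ∃ K : ℝ, 0 < K ∧ ∀ α : ℝ, |α| ≤ 1 / 2 →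
    ∃ u : ℤ → ℂ, ‖u 0‖ ≤ 1 ∧ (∀ h : ℤ, h ≠ 0 → ‖u h‖ ≤ K / (h : ℝ) ^ 2) ∧
      ∀ x : ℝ, HasSum (fun h : ℤ => u h * unitExp ((h + α) * x))
        ((Real.sin (Real.pi * x) ^ 2 : ℝ) * unitExp (α * ⌊x⌋)) := by
  have hpi := Real.pi_pos
  refine ⟨2 * Real.pi ^ 2 + Real.pi * Real.pi + (Real.pi * Real.pi + Real.pi * Real.pi),
    by positivity, fun α hα => ?_⟩
  set κ : ℂ := 2 * Real.pi * ((-α : ℝ) : ℂ) * Complex.I with hκ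
  have hκn : ‖κ‖ ≤ Real.pi := by
    have : ‖κ‖ = 2 * Real.pi * |α| := by simp [hκ, abs_of_pos hpi]
    rw [this]
    nlinarith
  set E : ℝ → ℂ := fun t => unitExp (-α * t) with hE
  have hEd : ∀ t, HasDerivAt E (κ * E t) t := fun t => hasDerivAt_unitExp_const_mul (-α) t
  have hEn : ∀ t, ‖E t‖ = 1 := fun t => norm_unitExp _
  set s : ℝ → ℂ := fun t => ((Real.sin (Real.pi * t) ^ 2 : ℝ) : ℂ) with hs
  set s' : ℝ → ℂ := fun t => ((Real.pi * Real.sin (2 * (Real.pi * t)) : ℝ) : ℂ) with hs'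
  set s'' : ℝ → ℂ := fun t => ((2 * Real.pi ^ 2 * Real.cos (2 * (Real.pi * t)) : ℝ) : ℂ) with hs''
  have hid : ∀ t : ℝ, HasDerivAt (fun t : ℝ => Real.pi * t) Real.pi t := fun t => by
    simpa using (hasDerivAt_id t).const_mul Real.pi
  have hsd : ∀ t, HasDerivAt s (s' t) t := fun t => by
    have := ((hid t).sin.pow 2).ofReal_comp
    convert! this using 1
    simp only [hs', Real.sin_two_mul]
    push_cast
    ring
  have hsd' : ∀ t, HasDerivAt s' (s'' t) t := fun t => by
    have := ((((hid t).const_mul 2).sin).const_mul Real.pi).ofReal_comp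
    convert! this using 1
    simp only [hs'']
    push_cast
    ring
  have hsn : ∀ t, ‖s t‖ ≤ 1 := fun t => by
    rw [hs, Complex.norm_real, Real.norm_eq_abs, abs_of_nonneg (sq_nonneg _)]
    exact Real.sin_sq_le_one _
  have hsn' : ∀ t, ‖s' t‖ ≤ Real.pi := fun t => by
    rw [hs', Complex.norm_real, Real.norm_eq_abs, abs_mul, abs_of_pos hpi]
    nlinarith [Real.abs_sin_le_one (2 * (Real.pi * t))]
  have hsn'' : ∀ t, ‖s'' t‖ ≤ 2 * Real.pi ^ 2 := fun t => by
    rw [hs'', Complex.norm_real, Real.norm_eq_abs, abs_mul, abs_of_pos (by positivity)]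
    nlinarith [Real.abs_cos_le_one (2 * (Real.pi * t)), sq_nonneg Real.pi]
  set f : ℝ → ℂ := fun t => s t * E t with hf
  set f' : ℝ → ℂ := fun t => s' t * E t + s t * (κ * E t) with hf'
  set f'' : ℝ → ℂ := fun t => (s'' t * E t + s' t * (κ * E t)) +
    (s' t * (κ * E t) + s t * (κ * (κ * E t))) with hf''
  have hfd : ∀ t, HasDerivAt f (f' t) t := fun t => (hsd t).mul (hEd t)
  have hfd' : ∀ t, HasDerivAt f' (f'' t) t := fun t =>
    ((hsd' t).mul (hEd t)).add ((hsd t).mul ((hEd t).const_mul κ))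
  have hEc : Continuous E := continuous_iff_continuousAt.mpr fun t => (hEd t).continuousAt
  have hfc : Continuous f := continuous_iff_continuousAt.mpr fun t => (hfd t).continuousAt
  have hfc'' : Continuous f'' := by
    simp only [hf'', hs, hs', hs'']
    fun_prop
  have h0 : f 0 = 0 := by simp [hf, hs]
  have h1 : f 1 = 0 := by simp [hf, hs]
  have h0' : f' 0 = 0 := by simp [hf', hs, hs']
  have h1' : f' 1 = 0 := by simp [hf', hs, hs']
  have hbound : ∀ t, ‖f'' t‖ ≤
      2 * Real.pi ^ 2 + Real.pi * Real.pi + (Real.pi * Real.pi + Real.pi * Real.pi) := by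
    intro t
    refine norm_add_le_of_le (norm_add_le_of_le ?_ ?_) (norm_add_le_of_le ?_ ?_) <;>
      simp only [norm_mul, hEn, mul_one]
    · exact hsn'' t
    · gcongr
      exact hsn' t
    · gcongr
      exact hsn' t
    · calc ‖s t‖ * (‖κ‖ * ‖κ‖) ≤ 1 * (Real.pi * Real.pi) := by
            gcongr
            exact hsn t
        _ = _ := one_mul _
  let B : C(AddCircle (1 : ℝ), ℂ) :=
    ⟨AddCircle.liftIco 1 0 f, AddCircle.liftIco_zero_continuous (by rw [h0, h1]) hfc.continuousOn⟩
  have hcoef : ∀ n, fourierCoeff B n = fourierCoeffOn (zero_lt_one' ℝ) f n := by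
    intro n
    have := fourierCoeff_liftIco_eq (T := 1) (a := 0) f n
    simp only [zero_add] at this
    exact this
  have hu0 : ‖fourierCoeff B 0‖ ≤ 1 := by
    rw [hcoef]
    refine fourierCoeffOn_zero_one_norm_le (fun t => ?_) 0
    rw [hf, norm_mul, hEn, mul_one]
    exact hsn t
  have hu : ∀ h : ℤ, h ≠ 0 → ‖fourierCoeff B h‖ ≤
      (2 * Real.pi ^ 2 + Real.pi * Real.pi + (Real.pi * Real.pi + Real.pi * Real.pi)) /
        (h : ℝ) ^ 2 := by
    intro h hh
    rw [hcoef]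
    exact fourierCoeffOn_zero_one_norm_le_div_sq hfd hfd' hfc'' h0 h1 h0' h1' hbound hh
  have hsum : Summable (fourierCoeff B) := by
    refine Summable.of_norm_bounded_eventually
      ((Real.summable_one_div_int_pow.mpr one_lt_two).mul_left _) (g := fun h : ℤ =>
      (2 * Real.pi ^ 2 + Real.pi * Real.pi + (Real.pi * Real.pi + Real.pi * Real.pi)) *
        (1 / (h : ℝ) ^ 2)) ?_
    filter_upwards [(Set.finite_singleton (0 : ℤ)).compl_mem_cofinite] with h hh
    rw [mul_one_div]
    exact hu h (by simpa using hh)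
  refine ⟨fourierCoeff B, hu0, hu, fun x => ?_⟩
  have hx := has_pointwise_sum_fourier_series_of_summable hsum ((Int.fract x : ℝ) : AddCircle (1 : ℝ))
  have hBx : B ((Int.fract x : ℝ) : AddCircle (1 : ℝ)) = f (Int.fract x) :=
    AddCircle.liftIco_zero_coe_apply (f := f) ⟨Int.fract_nonneg x, Int.fract_lt_one x⟩
  rw [hBx] at hx
  have hx := hx.mul_left (unitExp (α * x))
  have hfx : Int.fract x = x - ⌊x⌋ := rfl
  convert! hx using 1
  · ext h
    have e1 : fourier h ((Int.fract x : ℝ) : AddCircle (1 : ℝ)) = unitExp (h * x) := by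
      have e2 : unitExp (h * x) = unitExp (h * Int.fract x) := by
        have : (h : ℝ) * x = h * Int.fract x + ((h * ⌊x⌋ : ℤ) : ℝ) := by
          rw [hfx]
          push_cast
          ring
        rw [this, unitExp_add, unitExp_intCast, mul_one]
      rw [e2, fourier_coe_apply, unitExp]
      push_cast
      ring_nf
    rw [e1, add_mul, unitExp_add, smul_eq_mul]
    ring
  · have e1 : Real.sin (Real.pi * Int.fract x) ^ 2 = Real.sin (Real.pi * x) ^ 2 := by
      have : Real.pi * Int.fract x = Real.pi * x - ⌊x⌋ * Real.pi := by
        rw [hfx]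
        ring
      have h1 : ((-1 : ℝ) ^ ⌊x⌋) ^ 2 = 1 := by
        rw [sq, ← mul_zpow]
        simp
      rw [this, Real.sin_sq, Real.sin_sq, Real.cos_sub_int_mul_pi, mul_pow, h1, one_mul]
    have e2 : unitExp (α * ⌊x⌋) = unitExp (α * x) * unitExp (-α * Int.fract x) := by
      rw [← unitExp_add, hfx]
      ring_nf
    simp only [hf, hs, hE]
    rw [e1, e2]
    ring

/-- Bound for the smoothly weighted exponential sum over the values `⌊m ^ c⌋`. -/
lemma exists_norm_sum_sin_sq_mul_unitExp_floor_le {c : ℝ} (hc1 : 1 < c) (hc2 : c < 2) {L : ℕ}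
    (hL : 1 ≤ L) : ∃ C : ℝ, 0 < C ∧ ∀ Q : ℕ, 1 ≤ Q → ∀ α : ℝ, |α| ≤ 1 / 2 → α ≠ 0 →
      ‖∑ m ∈ Finset.Ico Q (L * Q),
          ((Real.sin (Real.pi * (m : ℝ) ^ c) ^ 2 : ℝ) : ℂ) * unitExp (α * ⌊(m : ℝ) ^ c⌋)‖ ≤
        C * ((Q : ℝ) ^ (c / 2) + (Q : ℝ) ^ (1 - c / 2) / √|α|) := by
  obtain ⟨C₁, hC₁, hS⟩ := exists_norm_sum_unitExp_rpow_le hc1 hc2 hL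
  obtain ⟨K, hK, hF⟩ := exists_hasSum_sin_sq_mul_unitExp_floor
  have hL0 : (1 : ℝ) ≤ L := by exact_mod_cast hL
  have hsumm : Summable fun h : ℤ => |(h : ℝ)| ^ (-(3 / 2) : ℝ) :=
    Real.summable_abs_int_rpow (by norm_num)
  set Z : ℝ := ∑' h : ℤ, |(h : ℝ)| ^ (-(3 / 2) : ℝ) with hZ
  have hZ0 : 0 ≤ Z := tsum_nonneg fun h => by positivity
  refine ⟨C₁ * L + K * C₁ * (2 * L + 2) * Z, by positivity, fun Q hQ α hα hα0 => ?_⟩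
  obtain ⟨u, hu0, hu, hsum⟩ := hF α hα
  have hQ1 : (1 : ℝ) ≤ Q := by exact_mod_cast hQ
  have hQ0 : (0 : ℝ) < Q := by linarith
  have hQL : Q ≤ L * Q := Nat.le_mul_of_pos_left Q hL
  have hSθ : ∀ θ : ℝ, θ ≠ 0 →
      ‖∑ m ∈ Finset.Ico Q (L * Q), unitExp (θ * (m : ℝ) ^ c)‖ ≤
        C₁ * (√|θ| * (L * (Q : ℝ) ^ (c / 2)) + (Q : ℝ) ^ (1 - c / 2) / √|θ|) := by
    intro θ hθ
    refine (hS Q hQ Q (L * Q) le_rfl hQL le_rfl θ hθ).trans ?_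
    have e : (Q : ℝ) ^ (c / 2) = (Q : ℝ) ^ (c / 2 - 1) * Q := by
      rw [Real.rpow_sub_one hQ0.ne']
      field_simp
    rw [e, mul_assoc]
    have h0 : 0 ≤ (Q : ℝ) ^ (c / 2 - 1) * Q := by positivity
    have h1 : (Q : ℝ) ^ (c / 2 - 1) * (((L * Q : ℕ) : ℝ) - Q) ≤
        L * ((Q : ℝ) ^ (c / 2 - 1) * Q) := by
      push_cast
      nlinarith
    exact mul_le_mul_of_nonneg_left
      (add_le_add (mul_le_mul_of_nonneg_left h1 (Real.sqrt_nonneg _)) le_rfl) hC₁.le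
  have hT := hasSum_sum (s := Finset.Ico Q (L * Q))
    fun m (_ : m ∈ Finset.Ico Q (L * Q)) => hsum ((m : ℝ) ^ c)
  simp_rw [← Finset.mul_sum] at hT
  set X : ℝ := C₁ * (L * (Q : ℝ) ^ (c / 2) + (Q : ℝ) ^ (1 - c / 2) / √|α|) with hX
  have hX0 : 0 ≤ X := by positivity
  set Y : ℝ := K * C₁ * (2 * L + 2) * (Q : ℝ) ^ (c / 2) with hY
  have hY0 : 0 ≤ Y := by positivity
  have hg : HasSum (fun h : ℤ => (if h = 0 then X else 0) + Y * |(h : ℝ)| ^ (-(3 / 2) : ℝ))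
      (X + Y * Z) := (hasSum_ite_eq 0 X).add (hsumm.hasSum.mul_left Y)
  have hbd : ∀ h : ℤ, ‖u h * ∑ m ∈ Finset.Ico Q (L * Q), unitExp ((h + α) * (m : ℝ) ^ c)‖ ≤
      (if h = 0 then X else 0) + Y * |(h : ℝ)| ^ (-(3 / 2) : ℝ) := by
    intro h
    rw [norm_mul]
    rcases eq_or_ne h 0 with rfl | hh
    · have h1 := hSθ α hα0
      have h2 : C₁ * (√|α| * (L * (Q : ℝ) ^ (c / 2)) + (Q : ℝ) ^ (1 - c / 2) / √|α|) ≤ X := by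
        have : √|α| ≤ 1 := Real.sqrt_le_one.mpr (by linarith)
        exact mul_le_mul_of_nonneg_left
          (add_le_add (mul_le_of_le_one_left (by positivity) this) le_rfl) hC₁.le
      have h3 : 0 ≤ Y * |((0 : ℤ) : ℝ)| ^ (-(3 / 2) : ℝ) := by positivity
      simp only [if_true, Int.cast_zero, zero_add] at h3 ⊢
      calc _ ≤ 1 * X := mul_le_mul hu0 (h1.trans h2) (norm_nonneg _) zero_le_one
        _ ≤ _ := by linarith
    · have hh1 : (1 : ℝ) ≤ |(h : ℝ)| := by exact_mod_cast Int.one_le_abs hh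
      have hlo : 1 / 4 ≤ |(h : ℝ) + α| := by
        have := abs_sub_abs_le_abs_sub (h : ℝ) (-α)
        rw [abs_neg, sub_neg_eq_add] at this
        linarith
      have hup : |(h : ℝ) + α| ≤ 4 * |(h : ℝ)| := by
        have := abs_add_le (h : ℝ) α
        linarith
      have hne : (h : ℝ) + α ≠ 0 := by
        intro h0
        rw [h0, abs_zero] at hlo
        linarith
      have hs1 : √|(h : ℝ) + α| ≤ 2 * √|(h : ℝ)| := by
        rw [show (2 : ℝ) = √4 by rw [show (4 : ℝ) = 2 ^ 2 by norm_num]; simp,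
          ← Real.sqrt_mul (by norm_num)]
        exact Real.sqrt_le_sqrt hup
      have hs2 : 1 / 2 ≤ √|(h : ℝ) + α| := Real.le_sqrt_of_sq_le (by linarith)
      have hs3 : 1 ≤ √|(h : ℝ)| := Real.one_le_sqrt.mpr hh1
      have hq : (Q : ℝ) ^ (1 - c / 2) ≤ (Q : ℝ) ^ (c / 2) :=
        Real.rpow_le_rpow_of_exponent_le hQ1 (by linarith)
      have h4 : (Q : ℝ) ^ (1 - c / 2) / √|(h : ℝ) + α| ≤ 2 * √|(h : ℝ)| * (Q : ℝ) ^ (c / 2) := by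
        rw [div_le_iff₀ (by linarith)]
        have h5 : 1 ≤ 2 * √|(h : ℝ)| * √|(h : ℝ) + α| := by nlinarith
        have h6 : 0 ≤ (Q : ℝ) ^ (c / 2) := by positivity
        nlinarith
      rw [if_neg hh, zero_add]
      have hrp : |(h : ℝ)| ^ (-(3 / 2) : ℝ) = √|(h : ℝ)| / (h : ℝ) ^ 2 := by
        rw [← sq_abs, Real.sqrt_eq_rpow, ← Real.rpow_natCast |(h : ℝ)| 2,
          ← Real.rpow_sub (by linarith)]
        norm_num
      calc _ ≤ K / (h : ℝ) ^ 2 * (C₁ * (2 * √|(h : ℝ)| * (L * (Q : ℝ) ^ (c / 2)) +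
            2 * √|(h : ℝ)| * (Q : ℝ) ^ (c / 2))) := by
            refine mul_le_mul (hu h hh) ((hSθ _ hne).trans ?_) (norm_nonneg _) (by positivity)
            gcongr
        _ = _ := by
            rw [hrp, hY]
            ring
  refine (hT.norm_le_of_bounded hg hbd).trans ?_
  rw [hX, hY]
  have h7 : 0 ≤ (Q : ℝ) ^ (1 - c / 2) / √|α| := by positivity
  have h8 : C₁ * ((Q : ℝ) ^ (1 - c / 2) / √|α|) ≤ C₁ * L * ((Q : ℝ) ^ (1 - c / 2) / √|α|) := by
    gcongr
    nlinarith
  have h9 : 0 ≤ K * C₁ * (2 * L + 2) * Z * ((Q : ℝ) ^ (1 - c / 2) / √|α|) := by positivity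
  linarith

open Polynomial in
/-- The averaging polynomial `(1 + X + ⋯ + X ^ (W - 1)) / W`. -/
noncomputable def averagingPoly (W : ℕ) : Polynomial ℂ :=
  C (1 / (W : ℂ)) * ∑ j ∈ Finset.range W, X ^ j

open Polynomial in
/-- The generating polynomial of the values `⌊m ^ c⌋`, `m ∈ [Q, L Q)`, with weights
`sin² (π m ^ c)`. -/
noncomputable def floorPowPoly (c : ℝ) (L Q : ℕ) : Polynomial ℂ :=
  ∑ m ∈ Finset.Ico Q (L * Q),
    C ((Real.sin (Real.pi * (m : ℝ) ^ c) ^ 2 : ℝ) : ℂ) * X ^ ⌊(m : ℝ) ^ c⌋₊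

lemma one_sub_eval_averagingPoly {W : ℕ} (hW : 1 ≤ W) (α : ℝ) :
    1 - (averagingPoly W).eval (unitExp α) =
      (1 / (W : ℂ)) * ∑ j ∈ Finset.range W, (1 - unitExp (j * α)) := by
  have hW0 : (W : ℂ) ≠ 0 := by exact_mod_cast (show W ≠ 0 by omega)
  simp only [averagingPoly, Polynomial.eval_mul, Polynomial.eval_C, Polynomial.eval_finsetSum,
    Polynomial.eval_pow, Polynomial.eval_X, Finset.sum_sub_distrib, Finset.sum_const,
    Finset.card_range, nsmul_eq_mul, mul_one, unitExp_nat_mul]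
  field_simp

lemma norm_one_sub_eval_averagingPoly_le_of_forall {W : ℕ} (hW : 1 ≤ W) {α B : ℝ}
    (hB : ∀ j < W, ‖1 - unitExp (j * α)‖ ≤ B) :
    ‖1 - (averagingPoly W).eval (unitExp α)‖ ≤ B := by
  have hW0 : (0 : ℝ) < W := by exact_mod_cast hW
  rw [one_sub_eval_averagingPoly hW, norm_mul]
  have h1 : ‖∑ j ∈ Finset.range W, (1 - unitExp (j * α))‖ ≤ W * B := by
    refine (norm_sum_le_of_le _ fun j hj => hB j (Finset.mem_range.mp hj)).trans ?_
    simp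
  have h2 : ‖(1 / (W : ℂ))‖ = 1 / W := by simp
  rw [h2]
  calc _ ≤ 1 / (W : ℝ) * (W * B) := by gcongr
    _ = B := by field_simp

lemma norm_one_sub_eval_averagingPoly_le_two {W : ℕ} (hW : 1 ≤ W) (α : ℝ) :
    ‖1 - (averagingPoly W).eval (unitExp α)‖ ≤ 2 :=
  norm_one_sub_eval_averagingPoly_le_of_forall hW fun j _ =>
    (norm_sub_le _ _).trans (by rw [norm_one, norm_unitExp]; norm_num)

lemma norm_one_sub_eval_averagingPoly_le {W : ℕ} (hW : 1 ≤ W) (α : ℝ) :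
    ‖1 - (averagingPoly W).eval (unitExp α)‖ ≤ 2 * Real.pi * √(W * |α|) := by
  have hpi := Real.two_le_pi
  rcases le_total 1 ((W : ℝ) * |α|) with h | h
  · have := Real.one_le_sqrt.mpr h
    exact (norm_one_sub_eval_averagingPoly_le_two hW α).trans (by nlinarith)
  · have h0 : 0 ≤ (W : ℝ) * |α| := by positivity
    have hle : (W : ℝ) * |α| ≤ √(W * |α|) := Real.le_sqrt_of_sq_le (by nlinarith)
    refine (norm_one_sub_eval_averagingPoly_le_of_forall hW (B := 2 * Real.pi * (W * |α|))
      fun j hj => ?_).trans (by gcongr)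
    rw [norm_sub_rev]
    refine (norm_unitExp_sub_one_le _).trans ?_
    rw [abs_mul, Nat.abs_cast]
    gcongr

lemma eval_floorPowPoly (c : ℝ) (L Q : ℕ) (α : ℝ) :
    (floorPowPoly c L Q).eval (unitExp α) = ∑ m ∈ Finset.Ico Q (L * Q),
      ((Real.sin (Real.pi * (m : ℝ) ^ c) ^ 2 : ℝ) : ℂ) * unitExp (α * ⌊(m : ℝ) ^ c⌋) := by
  simp only [floorPowPoly, Polynomial.eval_mul, Polynomial.eval_C, Polynomial.eval_finsetSum,
    Polynomial.eval_pow, Polynomial.eval_X]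
  refine Finset.sum_congr rfl fun m _ => ?_
  rw [← unitExp_nat_mul, natCast_floor_eq_intCast_floor (by positivity), mul_comm α]

lemma exists_unitExp_eq {z : ℂ} (hz : ‖z‖ = 1) : ∃ α : ℝ, |α| ≤ 1 / 2 ∧ z = unitExp α := by
  have hpi := Real.pi_pos
  refine ⟨z.arg / (2 * Real.pi), ?_, ?_⟩
  · rw [abs_div, abs_of_pos (by positivity : 0 < 2 * Real.pi), div_le_iff₀ (by positivity)]
    linarith [Complex.abs_arg_le_pi z]
  · rw [unitExp, mul_div_cancel₀ _ (by positivity)]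
    have := Complex.norm_mul_exp_arg_mul_I z
    rw [hz] at this
    simpa using this.symm

/-- Uniform bound on the unit circle for the difference between the generating polynomial and its
average over `W` consecutive shifts. -/
lemma exists_norm_eval_floorPowPoly_mul_le {c : ℝ} (hc1 : 1 < c) (hc2 : c < 2) {L : ℕ}
    (hL : 1 ≤ L) : ∃ C : ℝ, 0 < C ∧ ∀ Q : ℕ, 1 ≤ Q → ∀ W : ℕ, 1 ≤ W → ∀ z : ℂ, ‖z‖ = 1 →
      ‖(floorPowPoly c L Q * (1 - averagingPoly W)).eval z‖ ≤
        C * ((Q : ℝ) ^ (c / 2) + √W * (Q : ℝ) ^ (1 - c / 2)) := by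
  obtain ⟨C, hC, hT⟩ := exists_norm_sum_sin_sq_mul_unitExp_floor_le hc1 hc2 hL
  have hpi := Real.two_le_pi
  refine ⟨C * (2 * Real.pi), by positivity, fun Q hQ W hW z hz => ?_⟩
  obtain ⟨α, hα, rfl⟩ := exists_unitExp_eq hz
  rw [Polynomial.eval_mul, Polynomial.eval_sub, Polynomial.eval_one, norm_mul]
  have hk1 := norm_one_sub_eval_averagingPoly_le_two hW α
  have hk2 := norm_one_sub_eval_averagingPoly_le hW α
  rcases eq_or_ne α 0 with rfl | hα0
  · rw [abs_zero, mul_zero, Real.sqrt_zero, mul_zero] at hk2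
    rw [le_antisymm hk2 (norm_nonneg _), mul_zero]
    positivity
  have h1 := hT Q hQ α hα hα0
  rw [← eval_floorPowPoly] at h1
  have hs : 0 < √|α| := Real.sqrt_pos.mpr (abs_pos.mpr hα0)
  set k := ‖1 - (averagingPoly W).eval (unitExp α)‖ with hk
  have hk0 : 0 ≤ k := norm_nonneg _
  rw [Real.sqrt_mul (by positivity)] at hk2
  have h2 : (Q : ℝ) ^ (c / 2) * k ≤ (Q : ℝ) ^ (c / 2) * (2 * Real.pi) := by
    gcongr
    linarith
  have h3 : (Q : ℝ) ^ (1 - c / 2) / √|α| * k ≤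
      (Q : ℝ) ^ (1 - c / 2) / √|α| * (2 * Real.pi * (√W * √|α|)) := by gcongr
  have h4 : (Q : ℝ) ^ (1 - c / 2) / √|α| * (2 * Real.pi * (√W * √|α|)) =
      2 * Real.pi * (√W * (Q : ℝ) ^ (1 - c / 2)) := by field_simp
  calc _ ≤ C * ((Q : ℝ) ^ (c / 2) + (Q : ℝ) ^ (1 - c / 2) / √|α|) * k := by gcongr
    _ = C * ((Q : ℝ) ^ (c / 2) * k + (Q : ℝ) ^ (1 - c / 2) / √|α| * k) := by ring
    _ ≤ C * ((Q : ℝ) ^ (c / 2) * (2 * Real.pi) +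
        2 * Real.pi * (√W * (Q : ℝ) ^ (1 - c / 2))) := by
      rw [← h4]
      gcongr
    _ = _ := by ring

/-- If a polynomial is bounded by `B` on the unit circle, then multiplying it by a sum of `#P`
distinct monomials yields few large coefficients. -/
lemma card_mul_sq_le_of_norm_eval_le {ι : Type*} {G : Polynomial ℂ} {B t : ℝ}
    (ht : 0 < t)
    (hG : ∀ z : ℂ, ‖z‖ = 1 → ‖G.eval z‖ ≤ B) (P : Finset ι) (a : ι → ℕ)
    (ha : Set.InjOn a P) (E : Finset ℕ)
    (hE : ∀ n ∈ E, t ≤ ‖(G * ∑ p ∈ P, (Polynomial.X : Polynomial ℂ) ^ a p).coeff n‖) :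
    (E.card : ℝ) * t ^ 2 ≤ B ^ 2 * P.card := by
  set S : Polynomial ℂ := ∑ p ∈ P, Polynomial.X ^ a p with hS
  have hSsum : ∑ i ∈ S.support, ‖S.coeff i‖ ^ 2 ≤ P.card := by
    have hcoef : ∀ n, S.coeff n = if n ∈ P.image a then 1 else 0 := by
      intro n
      rw [hS, Polynomial.finsetSum_coeff]
      simp only [Polynomial.coeff_X_pow]
      split_ifs with h
      · obtain ⟨p, hp, rfl⟩ := Finset.mem_image.mp h
        rw [Finset.sum_eq_single p (fun q hq hqp => if_neg fun h => hqp (ha hq hp h.symm))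
          (fun h => absurd hp h), if_pos rfl]
      · refine Finset.sum_eq_zero fun p hp => if_neg fun h' => h ?_
        exact Finset.mem_image.mpr ⟨p, hp, h'.symm⟩
    have hsub : S.support ⊆ P.image a := by
      intro n hn
      by_contra h
      rw [Polynomial.mem_support_iff, hcoef, if_neg h] at hn
      exact hn rfl
    calc ∑ i ∈ S.support, ‖S.coeff i‖ ^ 2 ≤ ∑ i ∈ S.support, (1 : ℝ) := by
          refine Finset.sum_le_sum fun i _ => ?_
          rw [hcoef]
          split_ifs <;> simp
      _ = S.support.card := by simp
      _ ≤ P.card := by exact_mod_cast (Finset.card_le_card hsub).trans Finset.card_image_le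
  have hint : ∀ p : Polynomial ℂ, CircleIntegrable (fun z => ‖p.eval z‖ ^ 2) 0 1 := fun p =>
    ContinuousOn.circleIntegrable' (by fun_prop)
  have hpars : ∑ i ∈ (G * S).support, ‖(G * S).coeff i‖ ^ 2 ≤ B ^ 2 * P.card := by
    rw [Polynomial.sum_sq_norm_coeff_eq_circleAverage] at hSsum ⊢
    calc _ ≤ Real.circleAverage (fun z => B ^ 2 * ‖S.eval z‖ ^ 2) 0 1 := by
          refine Real.circleAverage_mono (hint _) ?_ fun z hz => ?_
          · exact ContinuousOn.circleIntegrable' (by fun_prop)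
          · rw [Polynomial.eval_mul, norm_mul, mul_pow]
            gcongr
            exact hG z (by simpa using hz)
      _ = B ^ 2 * Real.circleAverage (fun z => ‖S.eval z‖ ^ 2) 0 1 := by
          simpa [smul_eq_mul] using
            Real.circleAverage_fun_smul (a := B ^ 2) (f := fun z => ‖S.eval z‖ ^ 2) (c := 0) (R := 1)
      _ ≤ _ := by gcongr
  refine hpars.trans' ?_
  have hEsub : E ⊆ (G * S).support := by
    intro n hn
    have := hE n hn
    rw [Polynomial.mem_support_iff]
    intro h0
    rw [h0, norm_zero] at this
    linarith
  calc (E.card : ℝ) * t ^ 2 = ∑ n ∈ E, t ^ 2 := by simp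
    _ ≤ ∑ n ∈ E, ‖(G * S).coeff n‖ ^ 2 := by
      refine Finset.sum_le_sum fun n hn => ?_
      gcongr
      exact hE n hn
    _ ≤ _ := Finset.sum_le_sum_of_subset_of_nonneg hEsub fun _ _ _ => by positivity

lemma floor_rpow_injective {c : ℝ} (hc : 1 ≤ c) :
    Function.Injective fun n : ℕ => ⌊(n : ℝ) ^ c⌋₊ := by
  refine (strictMono_nat_of_lt_succ fun n => ?_).injective
  have h := Real.add_rpow_le_rpow_add n.cast_nonneg zero_le_one hc
  rw [Real.one_rpow] at h
  rw [← Nat.succ_le_iff, Nat.succ_eq_add_one, ← Nat.floor_add_one (by positivity)]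
  push_cast
  exact Nat.floor_le_floor h

lemma rpow_sub_rpow_le_mul_sub {c x y Z : ℝ} (hc : 1 ≤ c) (hx : 0 < x) (hxy : x ≤ y)
    (hyZ : y ≤ Z) : y ^ c - x ^ c ≤ c * Z ^ (c - 1) * (y - x) := by
  rcases hxy.eq_or_lt with rfl | hlt
  · simp
  obtain ⟨s, hs, hs'⟩ := exists_hasDerivAt_eq_slope (fun t : ℝ => t ^ c) _ hlt
    (fun s hs => (hasDerivAt_rpow_const' (hx.trans_le hs.1)).continuousAt.continuousWithinAt)
    (fun s hs => hasDerivAt_rpow_const' (hx.trans hs.1))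
  rw [eq_div_iff (sub_pos.mpr hlt).ne'] at hs'
  rw [← hs']
  have := hx.trans hs.1
  have := hs.2.le.trans hyZ
  have := sub_pos.mpr hlt
  gcongr

/-- Over intervals that are not too short, `sin² (π m ^ c)` has mean about `1 / 2`. -/
lemma exists_le_sum_sin_sq {c : ℝ} (hc1 : 1 < c) (hc2 : c < 2) {L : ℕ} (hL : 1 ≤ L) :
    ∃ C : ℝ, 0 < C ∧ ∀ Q : ℕ, 1 ≤ Q → ∀ a H : ℕ, Q ≤ a → a + H ≤ L * Q →
      (H : ℝ) / 2 - C * ((Q : ℝ) ^ (c / 2 - 1) * H + (Q : ℝ) ^ (1 - c / 2)) ≤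
        ∑ m ∈ Finset.Ico a (a + H), Real.sin (Real.pi * (m : ℝ) ^ c) ^ 2 := by
  obtain ⟨C, hC, h⟩ := exists_norm_sum_unitExp_rpow_le hc1 hc2 hL
  refine ⟨C, hC, fun Q hQ a H ha hH => ?_⟩
  have h1 := (Complex.abs_re_le_norm _).trans
    (h Q hQ a (a + H) ha (Nat.le_add_right _ _) hH 1 one_ne_zero)
  have h2 := (le_abs_self _).trans h1
  simp only [Complex.re_sum, unitExp_re, one_mul, abs_one, Real.sqrt_one, div_one] at h2
  push_cast at h2
  rw [add_sub_cancel_left] at h2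
  have h3 : ∑ m ∈ Finset.Ico a (a + H), Real.sin (Real.pi * (m : ℝ) ^ c) ^ 2 =
      (H : ℝ) / 2 - (∑ m ∈ Finset.Ico a (a + H), Real.cos (2 * Real.pi * (m : ℝ) ^ c)) / 2 := by
    have : ∀ m ∈ Finset.Ico a (a + H), Real.sin (Real.pi * (m : ℝ) ^ c) ^ 2 =
        1 / 2 - Real.cos (2 * Real.pi * (m : ℝ) ^ c) / 2 := fun m _ => by
      rw [Real.sin_sq_eq_half_sub, mul_assoc]
    rw [Finset.sum_congr rfl this, Finset.sum_sub_distrib, Finset.sum_div]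
    simp
    ring
  rw [h3]
  have h4 : 0 ≤ C * ((Q : ℝ) ^ (c / 2 - 1) * H + (Q : ℝ) ^ (1 - c / 2)) := by positivity
  linarith

/-- Each interval `(N - W, N]` contains `⌊m ^ c⌋` for `H` consecutive values of `m`. -/
lemma exists_window {c : ℝ} (hc : 1 ≤ c) {L Q H W N : ℕ} (hQ : 1 ≤ Q)
    (hW : c * ((L * Q : ℕ) : ℝ) ^ (c - 1) * (H + 1) ≤ W) (hN : (Q : ℝ) ^ c + W ≤ N)
    (hN' : (N : ℝ) + 1 ≤ ((L * Q : ℕ) : ℝ) ^ c) :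
    ∃ a, Q ≤ a ∧ a + H ≤ L * Q ∧
      ∀ m ∈ Finset.Ico a (a + H), ⌊(m : ℝ) ^ c⌋₊ ≤ N ∧ N < ⌊(m : ℝ) ^ c⌋₊ + W := by
  have hc0 : 0 < c := by linarith
  have hQ1 : (1 : ℝ) ≤ Q := by exact_mod_cast hQ
  have hex : ∃ a : ℕ, (N : ℝ) + 1 ≤ (a : ℝ) ^ c + W :=
    ⟨L * Q, hN'.trans (le_add_of_nonneg_right W.cast_nonneg)⟩
  classical
  set a := Nat.find hex with ha
  have ha1 : (N : ℝ) + 1 ≤ (a : ℝ) ^ c + W := Nat.find_spec hex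
  have hQa : Q < a := by
    by_contra! h
    have : (a : ℝ) ^ c ≤ (Q : ℝ) ^ c := by gcongr
    linarith
  obtain ⟨d, hd⟩ : ∃ d, a = d + 1 := ⟨a - 1, by omega⟩
  have hd1 : (d : ℝ) ^ c + W < N + 1 := by
    have := Nat.find_min hex (m := d) (by omega)
    simpa using this
  have hd0 : (0 : ℝ) < d := by exact_mod_cast (show 0 < d by omega)
  have hdZ : d ≤ L * Q := by
    by_contra! h
    have : ((L * Q : ℕ) : ℝ) ^ c ≤ (d : ℝ) ^ c := by gcongr
    have : (0 : ℝ) ≤ W := W.cast_nonneg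
    linarith
  have hK : 0 ≤ c * ((L * Q : ℕ) : ℝ) ^ (c - 1) := by positivity
  have haH : a + H ≤ L * Q := by
    by_contra! h
    have h1 := rpow_sub_rpow_le_mul_sub hc hd0 (Nat.cast_le.mpr hdZ) le_rfl
    have h2 : ((L * Q : ℕ) : ℝ) - d ≤ H + 1 := by
      have : ((L * Q : ℕ) : ℝ) ≤ ((d + H + 1 : ℕ) : ℝ) := Nat.cast_le.mpr (by omega)
      push_cast at this ⊢
      linarith
    have h3 := mul_le_mul_of_nonneg_left h2 hK
    linarith
  refine ⟨a, hQa.le, haH, fun m hm => ?_⟩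
  rw [Finset.mem_Ico] at hm
  constructor
  · have h1 := rpow_sub_rpow_le_mul_sub (y := ((a + H : ℕ) : ℝ)) hc hd0
      (Nat.cast_le.mpr (by omega)) (Nat.cast_le.mpr haH)
    have h2 : ((a + H : ℕ) : ℝ) - d = H + 1 := by
      rw [hd]
      push_cast
      ring
    rw [h2] at h1
    have h3 : (m : ℝ) ^ c ≤ ((a + H : ℕ) : ℝ) ^ c := by
      gcongr
      exact hm.2.le
    have h4 : (m : ℝ) ^ c < ((N + 1 : ℕ) : ℝ) := by
      push_cast at h3 h1 hW ⊢
      linarith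
    exact Nat.lt_succ_iff.mp ((Nat.floor_lt (by positivity)).mpr h4)
  · have h1 : (a : ℝ) ^ c ≤ (m : ℝ) ^ c := by
      gcongr
      exact hm.1
    have h2 := Nat.lt_floor_add_one ((m : ℝ) ^ c)
    have h3 : (N : ℝ) < (⌊(m : ℝ) ^ c⌋₊ + W : ℕ) := by
      push_cast
      linarith
    exact_mod_cast h3

open Polynomial in
/-- Coefficients of a sparse product minus its average over `W` consecutive shifts, at an exponent
which the sparse product misses. -/
lemma le_norm_coeff_mul_one_sub_averagingPoly {ι κ : Type*} {M : Finset ι} {P : Finset κ}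
    {w : ι → ℝ} (hw : ∀ m ∈ M, 0 ≤ w m) {b : ι → ℕ} {a : κ → ℕ} {n W : ℕ} {T : ℝ}
    (hn : ∀ m ∈ M, ∀ p ∈ P, b m + a p ≠ n)
    (hT : ∀ p ∈ P, ∃ I ⊆ M, (∀ m ∈ I, b m + a p ≤ n ∧ n < b m + a p + W) ∧ T ≤ ∑ m ∈ I, w m) :
    (P.card * T) / W ≤ ‖((∑ m ∈ M, C (w m : ℂ) * X ^ b m) * (1 - averagingPoly W) *
      ∑ p ∈ P, X ^ a p).coeff n‖ := by
  have hFS : (∑ m ∈ M, C (w m : ℂ) * X ^ b m) * ∑ p ∈ P, X ^ a p =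
      ∑ p ∈ P, ∑ m ∈ M, C (w m : ℂ) * X ^ (b m + a p) := by
    rw [Finset.sum_mul_sum, Finset.sum_comm]
    refine Finset.sum_congr rfl fun p _ => Finset.sum_congr rfl fun m _ => ?_
    rw [pow_add, mul_assoc]
  have hzero : (∑ p ∈ P, ∑ m ∈ M, C (w m : ℂ) * X ^ (b m + a p)).coeff n = 0 := by
    simp only [finsetSum_coeff, coeff_C_mul, coeff_X_pow]
    refine Finset.sum_eq_zero fun p hp => Finset.sum_eq_zero fun m hm => ?_
    rw [if_neg (hn m hm p hp).symm, mul_zero]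
  have havg : ((∑ p ∈ P, ∑ m ∈ M, C (w m : ℂ) * X ^ (b m + a p)) * averagingPoly W).coeff n =
      ((1 / W * ∑ p ∈ P, ∑ m ∈ M, ∑ j ∈ Finset.range W,
        if n = b m + a p + j then w m else 0 : ℝ) : ℂ) := by
    have : (∑ p ∈ P, ∑ m ∈ M, C (w m : ℂ) * X ^ (b m + a p)) * averagingPoly W =
        C (1 / (W : ℂ)) * ∑ p ∈ P, ∑ m ∈ M, ∑ j ∈ Finset.range W,
          C (w m : ℂ) * X ^ (b m + a p + j) := by
      rw [averagingPoly, mul_left_comm, Finset.sum_mul]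
      simp only [Finset.sum_mul, Finset.mul_sum, pow_add, mul_assoc]
      exact Finset.sum_congr rfl fun _ _ => Finset.sum_comm
    rw [this]
    simp only [finsetSum_coeff, coeff_C_mul, coeff_X_pow]
    push_cast
    simp only [mul_ite, mul_one, mul_zero, apply_ite Complex.ofReal, Complex.ofReal_zero]
  have hsplit : (∑ m ∈ M, C (w m : ℂ) * X ^ b m) * (1 - averagingPoly W) * ∑ p ∈ P, X ^ a p =
      ∑ p ∈ P, ∑ m ∈ M, C (w m : ℂ) * X ^ (b m + a p) -
      (∑ p ∈ P, ∑ m ∈ M, C (w m : ℂ) * X ^ (b m + a p)) * averagingPoly W := by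
    rw [← hFS]
    ring
  rw [hsplit, coeff_sub, hzero, havg, zero_sub, norm_neg, Complex.norm_real]
  refine le_trans ?_ (Real.le_norm_self _)
  rw [div_eq_inv_mul, ← one_div]
  refine mul_le_mul_of_nonneg_left ?_ (by positivity)
  rw [← nsmul_eq_mul]
  refine Finset.card_nsmul_le_sum _ _ _ fun p hp => ?_
  obtain ⟨I, hIM, hI, hTI⟩ := hT p hp
  refine hTI.trans ?_
  have hnn : ∀ m ∈ M, ∀ j, 0 ≤ if n = b m + a p + j then w m else 0 := fun m hm j => by
    split_ifs
    exacts [hw m hm, le_rfl]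
  calc ∑ m ∈ I, w m ≤ ∑ m ∈ I, ∑ j ∈ Finset.range W, if n = b m + a p + j then w m else 0 := by
        refine Finset.sum_le_sum fun m hm => ?_
        obtain ⟨h1, h2⟩ := hI m hm
        refine le_trans ?_ (Finset.single_le_sum (fun j _ => hnn m (hIM hm) j)
          (Finset.mem_range.mpr (show n - (b m + a p) < W by omega)))
        rw [if_pos (by omega)]
    _ ≤ _ := Finset.sum_le_sum_of_subset_of_nonneg hIM fun m hm _ =>
        Finset.sum_nonneg fun j _ => hnn m hm j

/-- Upper bound for the number of integers in a dyadic-type range that are not of the form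
`⌊m ^ c⌋ + ⌊p ^ c⌋`, in terms of a window length `H` and a shift length `W`. -/
lemma exists_card_exceptional_mul_le {c : ℝ} (hc1 : 1 < c) (hc2 : c < 2) {L : ℕ} (hL : 1 ≤ L) :
    ∃ C : ℝ, 0 < C ∧ ∀ Q H W : ℕ, 1 ≤ Q → 1 ≤ H →
      c * ((L * Q : ℕ) : ℝ) ^ (c - 1) * (H + 1) ≤ W → (W : ℝ) ≤ (Q : ℝ) ^ c →
      C * ((Q : ℝ) ^ (c / 2 - 1) * H + (Q : ℝ) ^ (1 - c / 2)) ≤ H / 4 →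
      ∀ E : Finset ℕ, (∀ n ∈ E, 3 * (Q : ℝ) ^ c ≤ n ∧ (n : ℝ) + 1 ≤ ((L * Q : ℕ) : ℝ) ^ c ∧
        ∀ m p : ℕ, 0 < m → p.Prime → ⌊(m : ℝ) ^ c⌋₊ + ⌊(p : ℝ) ^ c⌋₊ ≠ n) →
      E.card * Nat.primeCounting Q * (H : ℝ) ^ 2 ≤
        16 * C ^ 2 * (W : ℝ) ^ 2 * ((Q : ℝ) ^ (c / 2) + √W * (Q : ℝ) ^ (1 - c / 2)) ^ 2 := by
  obtain ⟨C₁, hC₁, hsin⟩ := exists_le_sum_sin_sq hc1 hc2 hL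
  obtain ⟨C₂, hC₂, hG⟩ := exists_norm_eval_floorPowPoly_mul_le hc1 hc2 hL
  refine ⟨max C₁ C₂, by positivity, fun Q H W hQ hH hW hWQ hHC E hE => ?_⟩
  have hQ1 : (1 : ℝ) ≤ Q := by exact_mod_cast hQ
  have hH1 : (1 : ℝ) ≤ H := by exact_mod_cast hH
  have hLQ : (0 : ℝ) < ((L * Q : ℕ) : ℝ) := by exact_mod_cast Nat.mul_pos hL hQ
  have hW0 : (0 : ℝ) < W := lt_of_lt_of_le (by positivity) hW
  have hW1 : 1 ≤ W := by exact_mod_cast hW0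
  set P : Finset ℕ := (Finset.range (Q + 1)).filter Nat.Prime with hP
  have hPcard : P.card = Nat.primeCounting Q := by
    rw [hP, Nat.primeCounting, Nat.primeCounting', Nat.count_eq_card_filter_range]
  have hHC₁ : C₁ * ((Q : ℝ) ^ (c / 2 - 1) * H + (Q : ℝ) ^ (1 - c / 2)) ≤ H / 4 :=
    (mul_le_mul_of_nonneg_right (le_max_left _ _) (by positivity)).trans hHC
  rcases Nat.eq_zero_or_pos (Nat.primeCounting Q) with h0 | hpi
  · rw [h0]
    simp only [Nat.cast_zero, mul_zero, zero_mul]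
    positivity
  have hpi' : (0 : ℝ) < Nat.primeCounting Q := by exact_mod_cast hpi
  have hcoef : ∀ n ∈ E, (P.card * ((H : ℝ) / 4)) / W ≤
      ‖(floorPowPoly c L Q * (1 - averagingPoly W) *
        ∑ p ∈ P, (Polynomial.X : Polynomial ℂ) ^ ⌊(p : ℝ) ^ c⌋₊).coeff n‖ := by
    intro n hn
    obtain ⟨hn1, hn2, hn3⟩ := hE n hn
    refine le_norm_coeff_mul_one_sub_averagingPoly (fun m _ => sq_nonneg _)
      (fun m hm p hp => hn3 m p ?_ (Finset.mem_filter.mp hp).2) fun p hp => ?_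
    · have := (Finset.mem_Ico.mp hm).1
      omega
    · have hpQ : p ≤ Q := by
        have := Finset.mem_range.mp (Finset.mem_filter.mp hp).1
        omega
      have hfl : (⌊(p : ℝ) ^ c⌋₊ : ℝ) ≤ (Q : ℝ) ^ c :=
        (Nat.floor_le (by positivity)).trans (by gcongr)
      have hle : ⌊(p : ℝ) ^ c⌋₊ ≤ n := by
        have : (⌊(p : ℝ) ^ c⌋₊ : ℝ) ≤ n := by
          have : 0 ≤ (Q : ℝ) ^ c := by positivity
          linarith
        exact_mod_cast this
      obtain ⟨a, haQ, haH, ha⟩ := exists_window hc1.le hQ hW (N := n - ⌊(p : ℝ) ^ c⌋₊)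
        (by rw [Nat.cast_sub hle]; linarith)
        (by
          rw [Nat.cast_sub hle]
          have : (0 : ℝ) ≤ ⌊(p : ℝ) ^ c⌋₊ := Nat.cast_nonneg _
          linarith)
      refine ⟨Finset.Ico a (a + H), Finset.Ico_subset_Ico haQ haH, fun m hm => ?_, ?_⟩
      · have := ha m hm
        omega
      · have := hsin Q hQ a H haQ haH
        linarith
  have key := card_mul_sq_le_of_norm_eval_le (by rw [hPcard]; positivity) (hG Q hQ W hW1) P _
    (floor_rpow_injective hc1.le).injOn E hcoef
  rw [hPcard] at key
  set Y : ℝ := (Q : ℝ) ^ (c / 2) + √W * (Q : ℝ) ^ (1 - c / 2) with hY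
  have h1 : E.card * Nat.primeCounting Q * (H : ℝ) ^ 2 * Nat.primeCounting Q ≤
      16 * C₂ ^ 2 * (W : ℝ) ^ 2 * Y ^ 2 * Nat.primeCounting Q := by
    have h2 := mul_le_mul_of_nonneg_right key (by positivity : (0 : ℝ) ≤ 16 * (W : ℝ) ^ 2)
    have h3 : E.card * (Nat.primeCounting Q * ((H : ℝ) / 4) / W) ^ 2 * (16 * (W : ℝ) ^ 2) =
        E.card * Nat.primeCounting Q * (H : ℝ) ^ 2 * Nat.primeCounting Q := by
      field_simp
      ring
    rw [h3] at h2
    linarith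
  refine (le_of_mul_le_mul_right h1 hpi').trans ?_
  gcongr
  exact le_max_right _ _

lemma eventually_rpow_le_primeCounting {ε : ℝ} (hε : 0 < ε) :
    ∀ᶠ Q : ℕ in Filter.atTop, (Q : ℝ) ^ (1 - ε) ≤ Nat.primeCounting Q := by
  have h1 := ((isLittleO_log_rpow_atTop hε).bound (show (0 : ℝ) < 1 / 4 by norm_num)).natCast_atTop
  have h2 := (Real.isLittleO_log_id_atTop.bound (show (0 : ℝ) < 1 / 8 by norm_num)).natCast_atTop
  filter_upwards [h1, h2, Filter.eventually_ge_atTop 3] with Q h1 h2 hQ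
  have hQ1 : (3 : ℝ) ≤ Q := by exact_mod_cast hQ
  have hlog : 0 < Real.log Q := Real.log_pos (by linarith)
  rw [Real.norm_of_nonneg hlog.le, Real.norm_of_nonneg (by positivity)] at h1
  rw [Real.norm_of_nonneg hlog.le, id, Real.norm_of_nonneg (by positivity)] at h2
  refine le_trans ?_ (Chebyshev.pi_ge Q)
  rw [le_div_iff₀ hlog]
  have h3 : (Q : ℝ) ^ (1 - ε) * (Q : ℝ) ^ ε = Q := by
    rw [← Real.rpow_add (by linarith)]
    simp
  have h4 : (Q : ℝ) ^ (1 - ε) * Real.log Q ≤ (Q : ℝ) ^ (1 - ε) * (1 / 4 * (Q : ℝ) ^ ε) := by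
    gcongr
  have h5 : Real.log (Q + 1) ≤ 2 * Real.log Q := by
    rw [← Real.log_rpow (by linarith) 2]
    refine Real.log_le_log (by linarith) ?_
    norm_num
    nlinarith
  have h6 := Real.log_two_gt_d9
  nlinarith

/-- Almost all integers between `3 Q ^ c` and `(L Q) ^ c - 1` are of the form
`⌊m ^ c⌋ + ⌊p ^ c⌋`. -/
lemma eventually_card_exceptional_le {c : ℝ} (hc1 : 1 < c) (hc2 : c < 3 / 2) {L : ℕ}
    (hL : 1 ≤ L) : ∀ᶠ Q : ℕ in Filter.atTop, ∀ E : Finset ℕ,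
      (∀ n ∈ E, 3 * (Q : ℝ) ^ c ≤ n ∧ (n : ℝ) + 1 ≤ ((L * Q : ℕ) : ℝ) ^ c ∧
        ∀ m p : ℕ, 0 < m → p.Prime → ⌊(m : ℝ) ^ c⌋₊ + ⌊(p : ℝ) ^ c⌋₊ ≠ n) →
      (E.card : ℝ) ≤ (Q : ℝ) ^ c := by
  obtain ⟨C, hC, hmain⟩ := exists_card_exceptional_mul_le hc1 (by linarith) hL
  obtain ⟨ε, hε, hε1, hε2⟩ : ∃ ε : ℝ, 0 < ε ∧ ε ≤ 3 / 2 - c ∧ 2 * ε < 1 - c / 2 :=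
    ⟨(3 - 2 * c) / 8, by linarith, by linarith, by linarith⟩
  set K : ℝ := 3 * c * (L : ℝ) ^ (c - 1) + 1 with hK
  have hK0 : 0 < K := by positivity
  have hlarge : ∀ s : ℝ, 0 < s → ∀ A : ℝ, ∀ᶠ Q : ℕ in Filter.atTop, A ≤ (Q : ℝ) ^ s :=
    fun s hs A => ((tendsto_rpow_atTop hs).comp tendsto_natCast_atTop_atTop).eventually_ge_atTop A
  filter_upwards [hlarge (c - 1 + 2 * ε) (by linarith) K, hlarge (1 - c / 2) (by linarith) (8 * C),
    hlarge (1 - c / 2 - 2 * ε) (by linarith) (8 * C),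
    hlarge ε hε (16 * C ^ 2 * K ^ 2 * (1 + √K) ^ 2),
    eventually_rpow_le_primeCounting hε, Filter.eventually_ge_atTop 1]
    with Q hQ1 hQ2 hQ3 hQ4 hpi hQ E hE
  set q : ℝ := (Q : ℝ) with hq
  have hq1 : 1 ≤ q := Nat.one_le_cast.mpr hQ
  have hq0 : 0 < q := by linarith
  have hmul : ∀ x y : ℝ, q ^ x * q ^ y = q ^ (x + y) := fun x y => (Real.rpow_add hq0 x y).symm
  have hmono : ∀ x y : ℝ, x ≤ y → q ^ x ≤ q ^ y := fun x y h =>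
    Real.rpow_le_rpow_of_exponent_le hq1 h
  have hone : ∀ x : ℝ, 0 ≤ x → 1 ≤ q ^ x := fun x h => Real.one_le_rpow hq1 h
  set H : ℕ := ⌈q ^ (2 - c - 2 * ε)⌉₊ with hH
  have hHlo : q ^ (2 - c - 2 * ε) ≤ H := Nat.le_ceil _
  have hH1' := hone (2 - c - 2 * ε) (by linarith)
  have hHup : (H : ℝ) ≤ q ^ (2 - c - 2 * ε) + 1 := (Nat.ceil_lt_add_one (by positivity)).le
  have hH1 : 1 ≤ H := Nat.one_le_ceil_iff.mpr (by positivity)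
  set W : ℕ := ⌈c * ((L * Q : ℕ) : ℝ) ^ (c - 1) * (H + 1)⌉₊ with hW
  have hWlo : c * ((L * Q : ℕ) : ℝ) ^ (c - 1) * (H + 1) ≤ W := Nat.le_ceil _
  have hWup : (W : ℝ) ≤ K * q ^ (1 - 2 * ε) := by
    have h1 : (W : ℝ) ≤ c * ((L * Q : ℕ) : ℝ) ^ (c - 1) * (H + 1) + 1 :=
      (Nat.ceil_lt_add_one (by positivity)).le
    have h2 : c * ((L * Q : ℕ) : ℝ) ^ (c - 1) * (H + 1) ≤
        c * ((L : ℝ) ^ (c - 1) * q ^ (c - 1)) * (3 * q ^ (2 - c - 2 * ε)) := by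
      push_cast
      rw [Real.mul_rpow (by positivity) (by positivity)]
      gcongr
      linarith
    have h3 : c * ((L : ℝ) ^ (c - 1) * q ^ (c - 1)) * (3 * q ^ (2 - c - 2 * ε)) =
        3 * c * (L : ℝ) ^ (c - 1) * q ^ (1 - 2 * ε) := by
      rw [show (1 - 2 * ε) = (c - 1) + (2 - c - 2 * ε) by ring, ← hmul]
      ring
    have h4 := hone (1 - 2 * ε) (by linarith)
    rw [hK, add_mul, one_mul]
    linarith
  have hWQ : (W : ℝ) ≤ q ^ c := by
    refine hWup.trans ?_
    rw [show c = (c - 1 + 2 * ε) + (1 - 2 * ε) by ring, ← hmul]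
    gcongr
  have hHC : C * (q ^ (c / 2 - 1) * H + q ^ (1 - c / 2)) ≤ H / 4 := by
    have h1 : C * q ^ (c / 2 - 1) ≤ 1 / 8 := by
      have h2 : q ^ (1 - c / 2) * q ^ (c / 2 - 1) = 1 := by
        rw [hmul]
        simp
      have h3 := mul_le_mul_of_nonneg_right hQ2 (by positivity : 0 ≤ q ^ (c / 2 - 1))
      rw [h2] at h3
      linarith
    have h4 : 8 * C * q ^ (1 - c / 2) ≤ q ^ (2 - c - 2 * ε) := by
      rw [show 2 - c - 2 * ε = (1 - c / 2 - 2 * ε) + (1 - c / 2) by ring, ← hmul]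
      gcongr
    have h5 := mul_le_mul_of_nonneg_right h1 (Nat.cast_nonneg (α := ℝ) H)
    linarith
  have hkey := hmain Q H W hQ hH1 hWlo hWQ hHC E hE
  have hB : q ^ (c / 2) + √W * q ^ (1 - c / 2) ≤ (1 + √K) * q ^ ((3 - c) / 2 - ε) := by
    have h1 := hmono (c / 2) ((3 - c) / 2 - ε) (by linarith)
    have h2 : √W ≤ √K * q ^ (1 / 2 - ε) := by
      have : √(K * q ^ (1 - 2 * ε)) = √K * q ^ (1 / 2 - ε) := by
        rw [Real.sqrt_mul hK0.le, Real.sqrt_eq_rpow (q ^ (1 - 2 * ε)), ← Real.rpow_mul hq0.le]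
        ring_nf
      rw [← this]
      exact Real.sqrt_le_sqrt hWup
    have h3 : √W * q ^ (1 - c / 2) ≤ √K * q ^ (1 / 2 - ε) * q ^ (1 - c / 2) := by gcongr
    rw [mul_assoc, hmul, show 1 / 2 - ε + (1 - c / 2) = (3 - c) / 2 - ε by ring] at h3
    linarith
  have hsq : ∀ x : ℝ, (q ^ x) ^ 2 = q ^ (2 * x) := fun x => by
    rw [sq, hmul]
    ring_nf
  have hlow : E.card * q ^ (5 - 2 * c - 5 * ε) ≤ E.card * (Nat.primeCounting Q : ℝ) * (H : ℝ) ^ 2 := by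
    rw [show 5 - 2 * c - 5 * ε = (1 - ε) + 2 * (2 - c - 2 * ε) by ring, ← hmul, ← hsq, ← mul_assoc]
    gcongr
  have hup : 16 * C ^ 2 * (W : ℝ) ^ 2 * (q ^ (c / 2) + √W * q ^ (1 - c / 2)) ^ 2 ≤
      16 * C ^ 2 * (K * q ^ (1 - 2 * ε)) ^ 2 * ((1 + √K) * q ^ ((3 - c) / 2 - ε)) ^ 2 := by
    gcongr
  have hup' : 16 * C ^ 2 * (K * q ^ (1 - 2 * ε)) ^ 2 * ((1 + √K) * q ^ ((3 - c) / 2 - ε)) ^ 2 =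
      16 * C ^ 2 * K ^ 2 * (1 + √K) ^ 2 * q ^ (c - ε) * q ^ (5 - 2 * c - 5 * ε) := by
    rw [mul_pow, mul_pow, hsq, hsq, mul_assoc _ (q ^ (c - ε)), hmul,
      show c - ε + (5 - 2 * c - 5 * ε) = 2 * (1 - 2 * ε) + 2 * ((3 - c) / 2 - ε) by ring, ← hmul]
    ring
  have hfin : (E.card : ℝ) ≤ 16 * C ^ 2 * K ^ 2 * (1 + √K) ^ 2 * q ^ (c - ε) :=
    le_of_mul_le_mul_right (by linarith) (by positivity : 0 < q ^ (5 - 2 * c - 5 * ε))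
  refine hfin.trans ?_
  calc _ ≤ q ^ ε * q ^ (c - ε) := by gcongr
    _ = q ^ c := by rw [hmul]; simp

lemma exists_floor_add_floor_eq_iff (c : ℝ) (n : ℕ) :
    (∃ m p : ℕ, 0 < m ∧ p.Prime ∧ ⌊(m : ℝ) ^ c⌋ + ⌊(p : ℝ) ^ c⌋ = (n : ℤ)) ↔
      ∃ m p : ℕ, 0 < m ∧ p.Prime ∧ ⌊(m : ℝ) ^ c⌋₊ + ⌊(p : ℝ) ^ c⌋₊ = n := by
  have h : ∀ k : ℕ, ⌊(k : ℝ) ^ c⌋ = (⌊(k : ℝ) ^ c⌋₊ : ℤ) := fun k =>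
    (Int.natCast_floor_eq_floor (by positivity)).symm
  simp only [h]
  norm_cast

/-- For `1 < c < 3/2`, the set of positive integers not representable as
`⌊m^c⌋ + ⌊p^c⌋` with `m ≥ 1` and `p` prime has natural density zero:
`E_c(x)/x → 0` as `x → ∞`. -/
theorem exceptional_set_density_zero (c : ℝ) (hc1 : 1 < c) (hc2 : c < 3 / 2) :
    Filter.Tendsto
      (fun x : ℝ =>
        (({n : ℕ | 0 < n ∧ (n : ℝ) ≤ x ∧ ¬∃ m p : ℕ, 0 < m ∧ p.Prime ∧
            ⌊(m : ℝ) ^ c⌋ + ⌊(p : ℝ) ^ c⌋ = (n : ℤ)}.ncard : ℝ) / x))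
      Filter.atTop (nhds (0 : ℝ)) := by
  have hc0 : 0 < c := by linarith
  simp only [exists_floor_add_floor_eq_iff]
  rw [Metric.tendsto_nhds]
  intro δ hδ
  obtain ⟨L, hL⟩ := exists_nat_gt (max 1 (40 / δ))
  have hL1 : (1 : ℝ) < L := (le_max_left _ _).trans_lt hL
  have hL1' : 1 ≤ L := by exact_mod_cast hL1.le
  have hLδ : 40 < δ * L := (div_lt_iff₀' hδ).mp ((le_max_right _ _).trans_lt hL)
  have hy : Filter.Tendsto (fun x : ℝ => (2 * x) ^ (1 / c)) Filter.atTop Filter.atTop :=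
    (tendsto_rpow_atTop (by positivity)).comp (Filter.tendsto_id.const_mul_atTop two_pos)
  have hQ : Filter.Tendsto (fun x : ℝ => ⌈(2 * x) ^ (1 / c) / L⌉₊) Filter.atTop Filter.atTop :=
    tendsto_nat_ceil_atTop.comp (hy.atTop_div_const (by linarith))
  filter_upwards [hQ.eventually (eventually_card_exceptional_le hc1 hc2 hL1'),
    hy.eventually_ge_atTop (L : ℝ), Filter.eventually_ge_atTop (1 : ℝ)] with x hcard hyL hx
  set y : ℝ := (2 * x) ^ (1 / c) with hydef
  set Q : ℕ := ⌈y / L⌉₊ with hQdef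
  have hyc : y ^ c = 2 * x := by
    rw [hydef, ← Real.rpow_mul (by linarith), one_div_mul_cancel hc0.ne', Real.rpow_one]
  have hQlo : y / L ≤ Q := Nat.le_ceil _
  have hQup : (Q : ℝ) ≤ 2 * y / L := by
    have h1 : (Q : ℝ) ≤ y / L + 1 := (Nat.ceil_lt_add_one (by positivity)).le
    have h2 : 1 ≤ y / L := (one_le_div (by linarith)).mpr hyL
    have h3 : 2 * y / L = y / L + y / L := by ring
    linarith
  have hQ1 : (1 : ℝ) ≤ Q := ((one_le_div (by linarith)).mpr hyL).trans hQlo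
  have hQc1 : 1 ≤ (Q : ℝ) ^ c := Real.one_le_rpow hQ1 hc0.le
  have hQc : (Q : ℝ) ^ c ≤ 8 * x / L := by
    have h1 : (Q : ℝ) ^ c ≤ (2 * y / L) ^ c := by gcongr
    have h2 : (2 * y / L) ^ c = 2 ^ c * (2 * x) / (L : ℝ) ^ c := by
      rw [Real.div_rpow (by positivity) (by positivity), Real.mul_rpow (by positivity)
        (by positivity), hyc]
    have h3 : (2 : ℝ) ^ c ≤ 4 := by
      calc (2 : ℝ) ^ c ≤ 2 ^ (2 : ℝ) := Real.rpow_le_rpow_of_exponent_le one_le_two (by linarith)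
        _ = 4 := by norm_num
    have h4 : (L : ℝ) ≤ (L : ℝ) ^ c := Real.self_le_rpow_of_one_le hL1.le hc1.le
    rw [h2] at h1
    refine h1.trans ?_
    calc 2 ^ c * (2 * x) / (L : ℝ) ^ c ≤ 4 * (2 * x) / L := by gcongr
      _ = 8 * x / L := by ring
  have hLQ : x + 1 ≤ ((L * Q : ℕ) : ℝ) ^ c := by
    have h1 : y ≤ ((L * Q : ℕ) : ℝ) := by
      push_cast
      exact (div_le_iff₀' (by linarith)).mp hQlo
    calc x + 1 ≤ y ^ c := by linarith
      _ ≤ _ := by gcongr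
  set S : Set ℕ := {n : ℕ | 0 < n ∧ (n : ℝ) ≤ x ∧ ¬∃ m p : ℕ, 0 < m ∧ p.Prime ∧
    ⌊(m : ℝ) ^ c⌋₊ + ⌊(p : ℝ) ^ c⌋₊ = n} with hS
  have hfin : S.Finite := (Set.finite_Iic ⌊x⌋₊).subset fun n hn => Nat.le_floor hn.2.1
  classical
  set E := hfin.toFinset.filter fun n : ℕ => 3 * (Q : ℝ) ^ c ≤ (n : ℝ) with hE
  have hEcard : (E.card : ℝ) ≤ (Q : ℝ) ^ c := by
    refine hcard E fun n hn => ?_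
    rw [hE, Finset.mem_filter, Set.Finite.mem_toFinset] at hn
    refine ⟨hn.2, by linarith [hn.1.2.1], fun m p hm hp h => hn.1.2.2 ⟨m, p, hm, hp, h⟩⟩
  have hsub : S ⊆ ((Finset.range ⌈3 * (Q : ℝ) ^ c⌉₊ ∪ E : Finset ℕ) : Set ℕ) := by
    intro n hn
    rw [Finset.mem_coe, Finset.mem_union]
    by_cases h : 3 * (Q : ℝ) ^ c ≤ n
    · exact Or.inr (Finset.mem_filter.mpr ⟨hfin.mem_toFinset.mpr hn, h⟩)
    · exact Or.inl (Finset.mem_range.mpr (Nat.lt_ceil.mpr (not_le.mp h)))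
  have hncard : S.ncard ≤ ⌈3 * (Q : ℝ) ^ c⌉₊ + E.card := by
    refine (Set.ncard_le_ncard hsub (Finset.finite_toSet _)).trans ?_
    rw [Set.ncard_coe_finset]
    simpa using Finset.card_union_le (Finset.range ⌈3 * (Q : ℝ) ^ c⌉₊) E
  have hncard' : (S.ncard : ℝ) ≤ ⌈3 * (Q : ℝ) ^ c⌉₊ + E.card := by exact_mod_cast hncard
  have hceil : (⌈3 * (Q : ℝ) ^ c⌉₊ : ℝ) ≤ 3 * (Q : ℝ) ^ c + 1 :=
    (Nat.ceil_lt_add_one (by positivity)).le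
  rw [Real.dist_0_eq_abs, abs_of_nonneg (by positivity), div_lt_iff₀ (by linarith)]
  calc (S.ncard : ℝ) ≤ 5 * (8 * x / L) := by linarith
    _ = 40 * x / L := by ring
    _ < δ * x := by
      rw [div_lt_iff₀ (by linarith)]
      nlinarith
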